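/- arXiv:2207.08956 — 2 statements merged into one kernel-verified Lean document; each statement's English description precedes it below -/
import Mathlib

section
/- Let X_0 be a 'ghost' context drawn from ν independently of the entire interaction history. Then the expected estimated regret in the ghost context equals the true expected regret: E[ Σ_{t=1}^n Σ_a (π*(a|X_0) − π_t(a|X_0))·⟨θ̂_t, φ(X_0,a)⟩ ] = E[ Σ_{t=1}^n Σ_a (π*(a|X_t) − π_t(a|X_t))·⟨θ_t, φ(X_t,a)⟩ ]. -/
open MeasureTheory ProbabilityTheory Matrix

lemma lp_indep_assoc {Ω α β γ : Type*} [MeasurableSpace Ω] [MeasurableSpace α] [MeasurableSpace β]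
    [MeasurableSpace γ] (μ : Measure Ω) [IsProbabilityMeasure μ] (U : Ω → α) (V : Ω → β) (W : Ω → γ)
    (hU : Measurable U) (hV : Measurable V) (hW : Measurable W)
    (h1 : IndepFun U (fun ω => (V ω, W ω)) μ) (h2 : IndepFun V W μ) :
    IndepFun (fun ω => (U ω, V ω)) W μ := by
  have h3 : IndepFun U V μ := h1.comp measurable_id measurable_fst
  rw [indepFun_iff_map_prod_eq_prod_map_map (by fun_prop) (by fun_prop)] at *
  rw [h2] at h1
  rw [h3]
  have : IsProbabilityMeasure (μ.map U) := Measure.isProbabilityMeasure_map hU.aemeasurable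
  have : IsProbabilityMeasure (μ.map V) := Measure.isProbabilityMeasure_map hV.aemeasurable
  have : IsProbabilityMeasure (μ.map W) := Measure.isProbabilityMeasure_map hW.aemeasurable
  have e : (fun ω => ((U ω, V ω), W ω)) =
      MeasurableEquiv.prodAssoc.symm ∘ (fun ω => (U ω, (V ω, W ω))) := rfl
  rw [e, ← Measure.map_map (MeasurableEquiv.measurable _) (by fun_prop), h1, ← Measure.prodAssoc_prod,
    MeasurableEquiv.map_symm_map]

lemma lp_map {Ω : Type*} [MeasurableSpace Ω] (μ : Measure Ω) [IsProbabilityMeasure μ]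
    {𝒳 : Type*} [MeasurableSpace 𝒳] (ν : Measure 𝒳) [IsProbabilityMeasure ν]
    {𝒜 : Type*} [Fintype 𝒜] [MeasurableSpace 𝒜] [MeasurableSingletonClass 𝒜]
    (πB : 𝒳 → 𝒜 → ℝ) (hπB_nonneg : ∀ x a, 0 ≤ πB x a) (hπB_sum : ∀ x, ∑ a, πB x a = 1)
    (hπB_meas : ∀ a, Measurable fun x => πB x a)
    (X : Ω → 𝒳) (A : Ω → 𝒜)
    (hX_meas : Measurable X) (hAB_meas : Measurable A)
    (h_law : ∀ (S : Set 𝒳), MeasurableSet S → ∀ a,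
      μ {ω | X ω ∈ S ∧ A ω = a} = ∫⁻ x in S, ENNReal.ofReal (πB x a) ∂ν) : μ.map X = ν := by
  ext S hS
  rw [Measure.map_apply hX_meas hS]
  have : X ⁻¹' S = ⋃ a ∈ (Finset.univ : Finset 𝒜), {ω | X ω ∈ S ∧ A ω = a} := by
    ext ω; simp
  rw [this, measure_biUnion_finset]
  · simp_rw [h_law S hS]
    rw [← lintegral_finsetSum _ (fun a _ => (hπB_meas a).ennreal_ofReal)]
    simp_rw [← ENNReal.ofReal_sum_of_nonneg (fun a _ => hπB_nonneg _ a), hπB_sum]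
    simp
  · intro a _ b _ hab
    refine Set.disjoint_left.2 ?_
    rintro ω ⟨_, h⟩ ⟨_, h'⟩
    exact hab (h.symm.trans h')
  · intro a _
    exact (hX_meas hS).inter (hAB_meas (measurableSet_singleton a))

lemma lp_integral {Ω : Type*} [MeasurableSpace Ω] (μ : Measure Ω) [IsProbabilityMeasure μ]
    {𝒳 : Type*} [MeasurableSpace 𝒳] (ν : Measure 𝒳) [IsProbabilityMeasure ν]
    {𝒜 : Type*} [Fintype 𝒜] [MeasurableSpace 𝒜] [MeasurableSingletonClass 𝒜]
    (πB : 𝒳 → 𝒜 → ℝ) (hπB_nonneg : ∀ x a, 0 ≤ πB x a) (hπB_sum : ∀ x, ∑ a, πB x a = 1)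
    (hπB_meas : ∀ a, Measurable fun x => πB x a)
    (X : Ω → 𝒳) (A : Ω → 𝒜)
    (hX_meas : Measurable X) (hAB_meas : Measurable A)
    (h_law : ∀ (S : Set 𝒳), MeasurableSet S → ∀ a,
      μ {ω | X ω ∈ S ∧ A ω = a} = ∫⁻ x in S, ENNReal.ofReal (πB x a) ∂ν)
    (g : 𝒳 → 𝒜 → ℝ) (hg : ∀ a, Measurable fun x => g x a) (C : ℝ)
    (hC : ∀ x a, |g x a| ≤ C) :
    ∫ ω, g (X ω) (A ω) ∂μ = ∫ x, ∑ a, πB x a * g x a ∂ν := by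
  have hr : ∀ a, (μ.restrict (A ⁻¹' {a})).map X = ν.withDensity fun x => ENNReal.ofReal (πB x a) := by
    intro a
    ext S hS
    rw [Measure.map_apply hX_meas hS, Measure.restrict_apply (hX_meas hS), withDensity_apply _ hS,
      ← h_law S hS a]
    rfl
  have h1 : ∀ ω, g (X ω) (A ω) = ∑ a, (A ⁻¹' {a}).indicator (fun ω => g (X ω) a) ω := by
    intro ω
    rw [Finset.sum_eq_single (A ω)]
    · simp
    · intro b _ hb
      simp [Set.indicator, hb.symm]
    · simp
  have hle : ∀ x a, πB x a ≤ 1 := fun x a => by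
    rw [← hπB_sum x]
    exact Finset.single_le_sum (fun b _ => hπB_nonneg x b) (Finset.mem_univ a)
  simp_rw [h1]
  rw [integral_finsetSum, integral_finsetSum]
  · refine Finset.sum_congr rfl fun a _ => ?_
    rw [integral_indicator (hAB_meas (measurableSet_singleton a)),
      ← integral_map (f := fun x => g x a) hX_meas.aemeasurable (hg a).aestronglyMeasurable, hr,
      integral_withDensity_eq_integral_toReal_smul (hπB_meas a).ennreal_ofReal (by simp)]
    simp [ENNReal.toReal_ofReal, hπB_nonneg]
  · intro a _
    refine Integrable.of_bound ((hπB_meas a).mul (hg a)).aestronglyMeasurable C (.of_forall fun x => ?_)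
    rw [Real.norm_eq_abs, abs_mul, abs_of_nonneg (hπB_nonneg x a)]
    nlinarith [hC x a, hle x a, abs_nonneg (g x a), hπB_nonneg x a]
  · intro a _
    refine Integrable.indicator ?_ (hAB_meas (measurableSet_singleton a))
    exact Integrable.of_bound ((hg a).comp hX_meas).aestronglyMeasurable C (.of_forall fun x => hC _ _)

/-- ghost-sample regret decomposition for LinProd. If `X₀` is a ghost
context with law `ν`, independent of the whole interaction history, then the expected
estimated regret in the ghost context equals the true expected regret:
`E[∑_t ∑_a (π*(a|X₀) − π_t(a|X₀))·⟨θ̂_t, φ(X₀,a)⟩]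
  = E[∑_t ∑_a (π*(a|X_t) − π_t(a|X_t))·⟨θ_t, φ(X_t,a)⟩]`. -/
theorem linprod_ghost_sample_regret_decomposition
    {Ω : Type*} [MeasurableSpace Ω] (μ : Measure Ω) [IsProbabilityMeasure μ]
    {𝒳 : Type*} [MeasurableSpace 𝒳] (ν : Measure 𝒳) [IsProbabilityMeasure ν]
    {𝒜 : Type*} [Fintype 𝒜] [DecidableEq 𝒜] [MeasurableSpace 𝒜] [MeasurableSingletonClass 𝒜]
    (K : ℕ) (hK : K = Fintype.card 𝒜) (hK2 : 2 ≤ K)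
    (d : ℕ) (φ : 𝒳 → 𝒜 → (Fin d → ℝ))
    (hφ_meas : ∀ a i, Measurable fun x => φ x a i)
    (B : ℝ) (hB : ∀ x a, ∑ i, φ x a i ^ 2 ≤ B)
    (n : ℕ) (θ : ℕ → Fin d → ℝ)
    (hθ : ∀ t x a, (∑ i, θ t i * φ x a i) ∈ Set.Icc (0 : ℝ) 1)
    (πB : 𝒳 → 𝒜 → ℝ) (hπB_nonneg : ∀ x a, 0 ≤ πB x a) (hπB_sum : ∀ x, ∑ a, πB x a = 1)
    (hπB_meas : ∀ a, Measurable fun x => πB x a)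
    (πstar : 𝒳 → 𝒜 → ℝ) (hπstar_nonneg : ∀ x a, 0 ≤ πstar x a)
    (hπstar_sum : ∀ x, ∑ a, πstar x a = 1)
    (hπstar_meas : ∀ a, Measurable fun x => πstar x a)
    (Vbar : (𝒳 → 𝒜 → ℝ) → Matrix (Fin d) (Fin d) ℝ)
    (hVbar : ∀ π i j, Vbar π i j = ∫ x, ∑ a, π x a * (φ x a i * φ x a j) ∂ν)
    (hdet : (Vbar πB).det ≠ 0)
    (η : ℝ) (hη : 0 < η)
    (X : ℕ → Ω → 𝒳) (AB : ℕ → Ω → 𝒜)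
    (hX_meas : ∀ t, Measurable (X t)) (hAB_meas : ∀ t, Measurable (AB t))
    (h_indep : iIndepFun (fun t ω => (X t ω, AB t ω)) μ)
    (h_law : ∀ t (S : Set 𝒳), MeasurableSet S → ∀ a,
      μ {ω | X t ω ∈ S ∧ AB t ω = a} = ∫⁻ x in S, ENNReal.ofReal (πB x a) ∂ν)
    (RB : ℕ → Ω → ℝ) (hRB : ∀ t ω, RB t ω = ∑ i, θ t i * φ (X t ω) (AB t ω) i)
    (θhat : ℕ → Ω → Fin d → ℝ)
    (hθhat : ∀ t ω,
      θhat t ω = (Vbar πB)⁻¹.mulVec fun i => φ (X t ω) (AB t ω) i * RB t ω)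
    (hpos : ∀ t ω x a, 0 < 1 + η * ∑ i, θhat t ω i * φ x a i)
    (w : ℕ → 𝒳 → 𝒜 → Ω → ℝ)
    (hw : ∀ t x a ω,
      w t x a ω = ∏ k ∈ Finset.range t, (1 + η * ∑ i, θhat k ω i * φ x a i))
    (pol : ℕ → 𝒳 → 𝒜 → Ω → ℝ)
    (hpol : ∀ t x a ω, pol t x a ω = w t x a ω / ∑ a', w t x a' ω)
    (X0 : Ω → 𝒳) (hX0_meas : Measurable X0) (hX0_law : Measure.map X0 μ = ν)
    (hX0_indep : IndepFun X0 (fun ω => fun t : Fin n => (X t ω, AB t ω)) μ) :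
    (∫ ω, ∑ t ∈ Finset.range n, ∑ a,
        (πstar (X0 ω) a - pol t (X0 ω) a ω) * (∑ i, θhat t ω i * φ (X0 ω) a i) ∂μ) =
      ∫ ω, ∑ t ∈ Finset.range n, ∑ a,
        (πstar (X t ω) a - pol t (X t ω) a ω) * (∑ i, θ t i * φ (X t ω) a i) ∂μ := by
  have hφb : ∀ x a i, |φ x a i| ≤ B + 1 := by
    intro x a i
    have h1 : φ x a i ^ 2 ≤ B :=
      (Finset.single_le_sum (f := fun i => φ x a i ^ 2) (fun j _ => sq_nonneg _)
        (Finset.mem_univ i)).trans (hB x a)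
    rw [abs_le]
    constructor <;> nlinarith [sq_nonneg (φ x a i - 1), sq_nonneg (φ x a i + 1)]
  have hφZ : ∀ i, Measurable fun z : 𝒳 × 𝒜 => φ z.1 z.2 i := fun i =>
    measurable_from_prod_countable_left fun a => hφ_meas a i
  have hZ : ∀ t, Measurable fun ω => (X t ω, AB t ω) := fun t =>
    (hX_meas t).prodMk (hAB_meas t)
  -- the estimator as a function of the observed pair
  let T : ℕ → 𝒳 × 𝒜 → Fin d → ℝ := fun t z i =>
    ∑ j, (Vbar πB)⁻¹ i j * (φ z.1 z.2 j * ∑ k, θ t k * φ z.1 z.2 k)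
  have hT : ∀ t ω i, θhat t ω i = T t (X t ω, AB t ω) i := by
    intro t ω i
    rw [hθhat, hRB]
    rfl
  have hT_meas : ∀ t i, Measurable fun z => T t z i := by
    intro t i
    refine Finset.measurable_sum _ fun j _ => ?_
    refine ((hφZ j).mul (Finset.measurable_sum _ fun k _ => (hφZ k).const_mul _)).const_mul _
  have hint2 : ∀ t j k, Integrable (fun ω => φ (X t ω) (AB t ω) j * φ (X t ω) (AB t ω) k) μ := by
    intro t j k
    refine Integrable.of_bound (((hφZ j).comp (hZ t)).mul
      ((hφZ k).comp (hZ t))).aestronglyMeasurable ((B + 1) * (B + 1)) (.of_forall fun ω => ?_)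
    rw [Real.norm_eq_abs, abs_mul]
    exact mul_le_mul (hφb _ _ _) (hφb _ _ _) (abs_nonneg _) ((abs_nonneg _).trans (hφb (X t ω) (AB t ω) j))
  have hTexp : ∀ t ω i, θhat t ω i = ∑ j, ∑ k, ((Vbar πB)⁻¹ i j * θ t k) *
      (φ (X t ω) (AB t ω) j * φ (X t ω) (AB t ω) k) := by
    intro t ω i
    rw [hT]
    refine Finset.sum_congr rfl fun j _ => ?_
    rw [Finset.mul_sum, Finset.mul_sum]
    refine Finset.sum_congr rfl fun k _ => ?_
    ring
  have hth_int : ∀ t i, Integrable (fun ω => θhat t ω i) μ := by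
    intro t i
    simp_rw [hTexp]
    exact integrable_finsetSum _ fun j _ => integrable_finsetSum _ fun k _ => (hint2 t j k).const_mul _
  have hth_mean : ∀ t i, ∫ ω, θhat t ω i ∂μ = θ t i := by
    intro t i
    have h2 : ∀ j k, ∫ ω, φ (X t ω) (AB t ω) j * φ (X t ω) (AB t ω) k ∂μ = Vbar πB j k := by
      intro j k
      rw [hVbar]
      refine lp_integral μ ν πB hπB_nonneg hπB_sum hπB_meas (X t) (AB t) (hX_meas t) (hAB_meas t)
        (h_law t) (fun x a => φ x a j * φ x a k) (fun a => (hφ_meas a j).mul (hφ_meas a k))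
        ((B + 1) * (B + 1)) ?_
      intro x a
      rw [abs_mul]
      exact mul_le_mul (hφb _ _ _) (hφb _ _ _) (abs_nonneg _) ((abs_nonneg _).trans (hφb x a j))
    simp_rw [hTexp]
    rw [integral_finsetSum _ fun j _ => integrable_finsetSum _ fun k _ => (hint2 t j k).const_mul _]
    have h3 : ∀ j, ∫ ω, ∑ k, ((Vbar πB)⁻¹ i j * θ t k) *
        (φ (X t ω) (AB t ω) j * φ (X t ω) (AB t ω) k) ∂μ
        = (Vbar πB)⁻¹ i j * (Vbar πB *ᵥ θ t) j := by
      intro j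
      rw [integral_finsetSum _ fun k _ => (hint2 t j k).const_mul _]
      simp_rw [integral_const_mul, h2, Matrix.mulVec, dotProduct, Finset.mul_sum]
      refine Finset.sum_congr rfl fun k _ => ?_
      ring
    simp_rw [h3]
    change ((Vbar πB)⁻¹ *ᵥ (Vbar πB *ᵥ θ t)) i = θ t i
    rw [Matrix.mulVec_mulVec, Matrix.nonsing_inv_mul _ (isUnit_iff_ne_zero.2 hdet), Matrix.one_mulVec]
  -- the policy as a function of the history
  let H : (t : ℕ) → Ω → (Fin t → 𝒳 × 𝒜) := fun t ω k => (X k ω, AB k ω)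
  have hH : ∀ t, Measurable (H t) := fun t => measurable_pi_lambda _ fun k => hZ k
  let Wt : (t : ℕ) → 𝒜 → 𝒳 × (Fin t → 𝒳 × 𝒜) → ℝ := fun t a p =>
    ∏ k : Fin t, (1 + η * ∑ i, T k (p.2 k) i * φ p.1 a i)
  have hWt_meas : ∀ t a, Measurable (Wt t a) := by
    intro t a
    refine Finset.measurable_prod _ fun k _ => ?_
    refine measurable_const.add (measurable_const.mul (Finset.measurable_sum _ fun i _ => ?_))
    exact ((hT_meas k i).comp ((measurable_pi_apply k).comp measurable_snd)).mul
      ((hφ_meas a i).comp measurable_fst)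
  have hwW : ∀ t x a ω, w t x a ω = Wt t a (x, H t ω) := by
    intro t x a ω
    rw [hw, Finset.prod_range]
    simp_rw [hT]
    rfl
  let G : (t : ℕ) → 𝒜 → Fin d → 𝒳 × (Fin t → 𝒳 × 𝒜) → ℝ := fun t a i p =>
    (πstar p.1 a - Wt t a p / ∑ a', Wt t a' p) * φ p.1 a i
  have hG_meas : ∀ t a i, Measurable (G t a i) := by
    intro t a i
    exact (((hπstar_meas a).comp measurable_fst).sub ((hWt_meas t a).div
      (Finset.measurable_sum _ fun a' _ => hWt_meas t a'))).mul ((hφ_meas a i).comp measurable_fst)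
  have hG : ∀ t x a ω i, G t a i (x, H t ω) = (πstar x a - pol t x a ω) * φ x a i := by
    intro t x a ω i
    rw [hpol]
    simp_rw [hwW]
    rfl
  have hG_bd : ∀ t x a ω i, |G t a i (x, H t ω)| ≤ B + 1 := by
    intro t x a ω i
    rw [hG, abs_mul]
    have hwp : ∀ a, 0 < w t x a ω := fun a => by
      rw [hw]; exact Finset.prod_pos fun k _ => hpos k ω x a
    have hws : w t x a ω ≤ ∑ a', w t x a' ω :=
      Finset.single_le_sum (fun b _ => (hwp b).le) (Finset.mem_univ a)
    have hp0 : 0 ≤ pol t x a ω := by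
      rw [hpol]; exact div_nonneg (hwp a).le ((hwp a).le.trans hws)
    have hp1 : pol t x a ω ≤ 1 := by
      rw [hpol]; exact div_le_one_of_le₀ hws ((hwp a).le.trans hws)
    have hs1 : πstar x a ≤ 1 := by
      rw [← hπstar_sum x]
      exact Finset.single_le_sum (fun b _ => hπstar_nonneg x b) (Finset.mem_univ a)
    have hd : |πstar x a - pol t x a ω| ≤ 1 := by
      rw [abs_le]; constructor <;> linarith [hπstar_nonneg x a]
    calc _ ≤ 1 * |φ x a i| := mul_le_mul_of_nonneg_right hd (abs_nonneg _)
      _ ≤ B + 1 := by rw [one_mul]; exact hφb x a i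
  -- independence
  have hHZ : ∀ t, IndepFun (H t) (fun ω => (X t ω, AB t ω)) μ := by
    intro t
    have h := h_indep.indepFun_finset (Finset.range t) {t} (by simp) hZ
    have m1 : Measurable (fun (f : Finset.range t → 𝒳 × 𝒜) (k : Fin t) =>
        f ⟨k, Finset.mem_range.2 k.2⟩) :=
      measurable_pi_lambda _ fun k => measurable_pi_apply _
    have m2 : Measurable (fun f : ({t} : Finset ℕ) → 𝒳 × 𝒜 =>
        f ⟨t, Finset.mem_singleton_self t⟩) := measurable_pi_apply _
    exact h.comp m1 m2
  have hX0HZ : ∀ t, t < n → IndepFun X0 (fun ω => (H t ω, (X t ω, AB t ω))) μ := by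
    intro t ht
    exact hX0_indep.comp (φ := id) (ψ := fun f : Fin n → 𝒳 × 𝒜 =>
        ((fun k : Fin t => f ⟨k, k.2.trans ht⟩), f ⟨t, ht⟩)) measurable_id
      ((measurable_pi_lambda _ fun k => measurable_pi_apply _).prodMk (measurable_pi_apply _))
  have hXlaw : ∀ t, μ.map (X t) = ν := fun t =>
    lp_map μ ν πB hπB_nonneg hπB_sum hπB_meas (X t) (AB t) (hX_meas t) (hAB_meas t) (h_law t)
  have hlaw : ∀ t, t < n → μ.map (fun ω => (X0 ω, H t ω)) = μ.map (fun ω => (X t ω, H t ω)) := by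
    intro t ht
    have h1 : IndepFun X0 (H t) μ := (hX0HZ t ht).comp measurable_id measurable_fst
    have h2 : IndepFun (X t) (H t) μ := ((hHZ t).comp measurable_id measurable_fst).symm
    rw [(indepFun_iff_map_prod_eq_prod_map_map hX0_meas.aemeasurable (hH t).aemeasurable).1 h1,
      (indepFun_iff_map_prod_eq_prod_map_map (hX_meas t).aemeasurable (hH t).aemeasurable).1 h2,
      hX0_law, hXlaw]
  have hGm : ∀ t a i (Y : Ω → 𝒳), Measurable Y →
      AEStronglyMeasurable (fun ω => G t a i (Y ω, H t ω)) μ := fun t a i Y hY =>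
    ((hG_meas t a i).comp (hY.prodMk (hH t))).aestronglyMeasurable
  have hL_int : ∀ t a i, Integrable (fun ω => G t a i (X0 ω, H t ω) * θhat t ω i) μ := by
    intro t a i
    exact (hth_int t i).bdd_mul (hGm t a i X0 hX0_meas) (.of_forall fun ω => hG_bd t _ a ω i)
  have hR_int : ∀ t a i, Integrable (fun ω => G t a i (X t ω, H t ω) * θ t i) μ := by
    intro t a i
    exact (Integrable.of_bound (hGm t a i (X t) (hX_meas t)) (B + 1)
      (.of_forall fun ω => hG_bd t _ a ω i)).mul_const _
  have hkey : ∀ t, t < n → ∀ a i, ∫ ω, G t a i (X0 ω, H t ω) * θhat t ω i ∂μ =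
      ∫ ω, G t a i (X t ω, H t ω) * θ t i ∂μ := by
    intro t ht a i
    have hI := lp_indep_assoc μ X0 (H t) (fun ω => (X t ω, AB t ω)) hX0_meas (hH t) (hZ t)
      (hX0HZ t ht) (hHZ t)
    have hI2 : IndepFun (fun ω => G t a i (X0 ω, H t ω)) (fun ω => θhat t ω i) μ := by
      simp_rw [hT]
      exact hI.comp (hG_meas t a i) (hT_meas t i)
    rw [hI2.integral_fun_mul_eq_mul_integral (hGm t a i X0 hX0_meas)
      (hth_int t i).aestronglyMeasurable, hth_mean, integral_mul_const]
    congr 1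
    rw [← integral_map (φ := fun ω => (X0 ω, H t ω)) (f := G t a i)
        (hX0_meas.prodMk (hH t)).aemeasurable (hG_meas t a i).aestronglyMeasurable,
      ← integral_map (φ := fun ω => (X t ω, H t ω)) (f := G t a i)
        ((hX_meas t).prodMk (hH t)).aemeasurable (hG_meas t a i).aestronglyMeasurable, hlaw t ht]
  have eL : ∀ ω, (∑ t ∈ Finset.range n, ∑ a,
        (πstar (X0 ω) a - pol t (X0 ω) a ω) * (∑ i, θhat t ω i * φ (X0 ω) a i)) =
      ∑ t ∈ Finset.range n, ∑ a, ∑ i, G t a i (X0 ω, H t ω) * θhat t ω i := by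
    intro ω
    refine Finset.sum_congr rfl fun t _ => Finset.sum_congr rfl fun a _ => ?_
    rw [Finset.mul_sum]
    refine Finset.sum_congr rfl fun i _ => ?_
    rw [hG]; ring
  have eR : ∀ ω, (∑ t ∈ Finset.range n, ∑ a,
        (πstar (X t ω) a - pol t (X t ω) a ω) * (∑ i, θ t i * φ (X t ω) a i)) =
      ∑ t ∈ Finset.range n, ∑ a, ∑ i, G t a i (X t ω, H t ω) * θ t i := by
    intro ω
    refine Finset.sum_congr rfl fun t _ => Finset.sum_congr rfl fun a _ => ?_
    rw [Finset.mul_sum]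
    refine Finset.sum_congr rfl fun i _ => ?_
    rw [hG]; ring
  rw [integral_congr_ae (.of_forall eL), integral_congr_ae (.of_forall eR)]
  rw [integral_finsetSum _ fun t _ => integrable_finsetSum _ fun a _ =>
      integrable_finsetSum _ fun i _ => hL_int t a i,
    integral_finsetSum _ fun t _ => integrable_finsetSum _ fun a _ =>
      integrable_finsetSum _ fun i _ => hR_int t a i]
  refine Finset.sum_congr rfl fun t ht => ?_
  rw [integral_finsetSum _ fun a _ => integrable_finsetSum _ fun i _ => hL_int t a i,
    integral_finsetSum _ fun a _ => integrable_finsetSum _ fun i _ => hR_int t a i]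
  refine Finset.sum_congr rfl fun a _ => ?_
  rw [integral_finsetSum _ fun i _ => hL_int t a i, integral_finsetSum _ fun i _ => hR_int t a i]
  exact Finset.sum_congr rfl fun i _ => hkey t (Finset.mem_range.1 ht) a i
end

section
/- Consider the Exp3 variant of the algorithm obtained by setting all IX parameters γ_t = 0, i.e., using the unbiased estimates r̂_t(a) = r_t(a)·1{A^B_t = a}/π_B(a) in the exponential-weights update. Then for any comparator policy π* ∈ Δ_𝒜 and any learning rate η > 0, the expected regret satisfies E[R(π*)] ≤ (log K)/η + η·Σ_{t=1}^n Σ_{a∈𝒜} E[π_t(a)]/π_B(a). -/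
open MeasureTheory ProbabilityTheory

/-! ### Finite product expectations -/

noncomputable def EE {ι α : Type*} [Fintype ι] [DecidableEq ι] [Fintype α] (w : α → ℝ)
    (F : (ι → α) → ℝ) : ℝ := ∑ s, (∏ k, w (s k)) * F s

section EEsec
variable {ι α β : Type*} [Fintype ι] [DecidableEq ι] [Fintype α] [Fintype β]

lemma EE_mono {w : α → ℝ} (hw : ∀ a, 0 ≤ w a) {F G : (ι → α) → ℝ} (h : ∀ s, F s ≤ G s) :
    EE w F ≤ EE w G :=
  Finset.sum_le_sum fun s _ => mul_le_mul_of_nonneg_left (h s) (Finset.prod_nonneg fun k _ => hw _)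

lemma EE_add (w : α → ℝ) (F G : (ι → α) → ℝ) :
    EE w (fun s => F s + G s) = EE w F + EE w G := by
  simp [EE, mul_add, Finset.sum_add_distrib]

lemma EE_sub (w : α → ℝ) (F G : (ι → α) → ℝ) :
    EE w (fun s => F s - G s) = EE w F - EE w G := by
  simp [EE, mul_sub, Finset.sum_sub_distrib]

lemma EE_mul (w : α → ℝ) (c : ℝ) (F : (ι → α) → ℝ) :
    EE w (fun s => c * F s) = c * EE w F := by
  simp only [EE, Finset.mul_sum]
  exact Finset.sum_congr rfl fun s _ => by ring

lemma EE_sum {κ : Type*} (S : Finset κ) (w : α → ℝ) (F : κ → (ι → α) → ℝ) :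
    EE w (fun s => ∑ i ∈ S, F i s) = ∑ i ∈ S, EE w (F i) := by
  simp only [EE, Finset.mul_sum]
  rw [Finset.sum_comm]

lemma EE_const {w : α → ℝ} (h1 : ∑ a, w a = 1) (c : ℝ) :
    EE w (fun _ : ι → α => c) = c := by
  have : (∑ s : ι → α, ∏ k, w (s k)) = 1 := by
    have := Finset.prod_univ_sum (fun _ : ι => (Finset.univ : Finset α)) (fun _ a => w a)
    rw [Fintype.piFinset_univ] at this
    rw [← this]; simp [h1]
  simp only [EE, ← Finset.sum_mul, this, one_mul]

lemma EE_nonneg {w : α → ℝ} (hw : ∀ a, 0 ≤ w a) {F : (ι → α) → ℝ} (h : ∀ s, 0 ≤ F s) :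
    0 ≤ EE w F :=
  Finset.sum_nonneg fun s _ => mul_nonneg (Finset.prod_nonneg fun k _ => hw _) (h s)

lemma EE_push [DecidableEq β] (φ : α → β) (w : α → ℝ) (w' : β → ℝ)
    (h : ∀ b, w' b = ∑ a, if φ a = b then w a else 0) (F : (ι → β) → ℝ) :
    EE w' F = EE w (fun s => F (fun k => φ (s k))) := by
  classical
  have h2 : ∀ s : ι → β, ∏ k, w' (s k) =
      ∑ u : ι → α, if (fun k => φ (u k)) = s then ∏ k, w (u k) else 0 := by
    intro s
    have := Finset.prod_univ_sum (fun _ : ι => (Finset.univ : Finset α))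
      (fun k a => if φ a = s k then w a else 0)
    rw [Fintype.piFinset_univ] at this
    simp only [h]
    rw [this]
    refine Finset.sum_congr rfl fun u _ => ?_
    split_ifs with hu
    · refine Finset.prod_congr rfl fun k _ => ?_
      rw [if_pos (congrFun hu k)]
    · have : ∃ k, φ (u k) ≠ s k := by
        by_contra hh; push Not at hh; exact hu (funext hh)
      obtain ⟨k, hk⟩ := this
      exact Finset.prod_eq_zero (Finset.mem_univ k) (if_neg hk)
  simp only [EE, h2, Finset.sum_mul]
  rw [Finset.sum_comm]
  refine Finset.sum_congr rfl fun u _ => ?_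
  simp [ite_mul]

lemma EE_prod (w1 : α → ℝ) (w2 : β → ℝ) (F : (ι → α × β) → ℝ) :
    EE (fun p : α × β => w1 p.1 * w2 p.2) F =
      EE w1 (fun s1 => EE w2 (fun s2 => F (fun k => (s1 k, s2 k)))) := by
  simp only [EE, Finset.mul_sum]
  rw [← Fintype.sum_prod_type']
  refine Fintype.sum_equiv (Equiv.arrowProdEquivProdArrow ι (fun _ => α) (fun _ => β)) _ _ ?_
  intro s
  simp [Equiv.arrowProdEquivProdArrow, Finset.prod_mul_distrib, mul_assoc]

lemma EE_resample {w : α → ℝ} (h1 : ∑ a, w a = 1) (t : ι) (F : (ι → α) → ℝ) :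
    EE w F = EE w (fun s => ∑ a, w a * F (Function.update s t a)) := by
  classical
  simp only [EE, Finset.mul_sum]
  rw [← Fintype.sum_prod_type']
  have key : ∀ G : (ι → α) → ℝ, ∑ s, G s = ∑ p : (ι → α) × α, w p.2 * G p.1 := by
    intro G
    rw [Fintype.sum_prod_type]
    simp [← Finset.sum_mul, h1]
  rw [key]
  let e : ((ι → α) × α) ≃ ((ι → α) × α) :=
    { toFun := fun p => (Function.update p.1 t p.2, p.1 t)
      invFun := fun p => (Function.update p.1 t p.2, p.1 t)
      left_inv := by intro p; simp
      right_inv := by intro p; simp }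
  refine Fintype.sum_equiv e _ _ ?_
  rintro ⟨s, a⟩
  simp only [e, Equiv.coe_fn_mk, Function.update_idem, Function.update_eq_self]
  have : w a * ∏ k, w (s k) = (∏ k, w (Function.update s t a k)) * w (s t) := by
    rw [← Finset.mul_prod_erase _ _ (Finset.mem_univ t),
      ← Finset.mul_prod_erase _ (fun k => w (Function.update s t a k)) (Finset.mem_univ t)]
    have : ∏ k ∈ Finset.univ.erase t, w (Function.update s t a k) =
        ∏ k ∈ Finset.univ.erase t, w (s k) := by
      refine Finset.prod_congr rfl fun k hk => ?_
      rw [Function.update_of_ne (Finset.ne_of_mem_erase hk)]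
    rw [this]; simp; ring
  calc w a * ((∏ k, w (s k)) * F s) = (w a * ∏ k, w (s k)) * F s := by ring
    _ = _ := by rw [this]; ring

end EEsec

/-! ### Bernoulli sequences -/

noncomputable def bw (q : ℝ) (b : Bool) : ℝ := if b then q else 1 - q

lemma bw_nonneg {q : ℝ} (h0 : 0 ≤ q) (h1 : q ≤ 1) (b : Bool) : 0 ≤ bw q b := by
  unfold bw; split_ifs <;> linarith

lemma bw_sum (q : ℝ) : ∑ b, bw q b = 1 := by simp [bw]

noncomputable def Zf {ι : Type*} [Fintype ι] (y : ι → ℝ) (q : ℝ) (B : ι → Bool) : ℝ :=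
  ∑ k, y k * ((if B k then 1 else 0) - q)

section bern
variable {ι : Type*} [Fintype ι] [DecidableEq ι]

lemma harris {q : ℝ} (h0 : 0 ≤ q) (h1 : q ≤ 1) {f g : (ι → Bool) → ℝ} (hf0 : ∀ s, 0 ≤ f s)
    (hg0 : ∀ s, 0 ≤ g s) (hf : Monotone f) (hg : Monotone g) :
    EE (bw q) f * EE (bw q) g ≤ EE (bw q) (fun s => f s * g s) := by
  have := fkg (μ := fun s : ι → Bool => ∏ k, bw q (s k)) (f := f) (g := g)
    (fun s => Finset.prod_nonneg fun k _ => bw_nonneg h0 h1 _) hf0 hg0 hf hg ?_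
  · have e := EE_const (ι := ι) (bw_sum q) 1
    simp only [EE, mul_one] at e
    rw [e, one_mul] at this
    exact this
  · intro a b
    rw [← Finset.prod_mul_distrib, ← Finset.prod_mul_distrib]
    apply le_of_eq
    refine Finset.prod_congr rfl fun k _ => ?_
    simp only [Pi.inf_apply, Pi.sup_apply]
    cases a k <;> cases b k <;> simp [mul_comm]

lemma Zf_mono {y : ι → ℝ} (hy : ∀ k, 0 ≤ y k) (q : ℝ) : Monotone (Zf y q) := by
  intro s u h
  refine Finset.sum_le_sum fun k _ => mul_le_mul_of_nonneg_left ?_ (hy k)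
  have := h k
  rcases Bool.eq_false_or_eq_true (s k) with h1 | h1 <;>
    rcases Bool.eq_false_or_eq_true (u k) with h2 | h2 <;> rw [h1, h2] at this <;>
    first | (simp [h1, h2]; done) | (exact absurd (Bool.le_iff_imp.1 this rfl) (by simp))

lemma EE_symm (G : ℝ → ℝ) (c : ℝ) (hG : ∀ z, 2 * c ≤ G z + G (-z)) (y : ι → ℝ) :
    c ≤ EE (bw (1/2)) (fun B => G (Zf y (1/2) B)) := by
  have e1 := EE_push (ι := ι) (fun b : Bool => !b) (bw (1/2)) (bw (1/2))
    (by intro b; cases b <;> simp [bw] <;> norm_num) (fun B => G (Zf y (1/2) B))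
  have e2 : ∀ B : ι → Bool, Zf y (1/2) (fun k => !(B k)) = - Zf y (1/2) B := by
    intro B
    simp only [Zf, ← Finset.sum_neg_distrib]
    refine Finset.sum_congr rfl fun k _ => ?_
    rcases Bool.eq_false_or_eq_true (B k) with h | h <;> simp only [h] <;> norm_num
  simp only [e2] at e1
  have e3 := EE_add (bw (1/2)) (fun B : ι → Bool => G (Zf y (1/2) B)) (fun B => G (- Zf y (1/2) B))
  have e4 := EE_mono (ι := ι) (bw_nonneg (q := 1/2) (by norm_num) (by norm_num))
    (fun B => hG (Zf y (1/2) B))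
  rw [EE_const (bw_sum _)] at e4
  linarith

lemma EE_half {G : ℝ → ℝ} (hG : Monotone G) (hG0 : ∀ z, 0 ≤ G z) {c q : ℝ} (hc : 0 ≤ c)
    (hq0 : 0 ≤ q) (hq1 : q ≤ 1)
    (ih : ∀ y : ι → ℝ, (∀ k, 0 ≤ y k) → c ≤ EE (bw q) (fun B => G (Zf y q B)))
    (y : ι → ℝ) (hy : ∀ k, 0 ≤ y k) :
    c / 2 ≤ EE (bw (q/2)) (fun B => G (Zf y (q/2) B)) := by
  rw [EE_push (fun p : Bool × Bool => p.1 && p.2) (fun p => bw (1/2) p.1 * bw q p.2) (bw (q/2))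
    (by intro b; cases b <;> simp [Fintype.sum_prod_type, bw] <;> ring), EE_prod]
  let I : ℝ → ℝ := fun z => if 0 ≤ z then c else 0
  have h1 := EE_symm (ι := ι) I (c/2) (by
    intro z; simp only [I]
    split_ifs <;> linarith) (fun k => q * y k)
  refine h1.trans (EE_mono (bw_nonneg (by norm_num) (by norm_num)) fun F => ?_)
  simp only [I]
  split_ifs with hz
  · refine (ih (fun k => y k * (if F k then 1 else 0)) ?_).trans
      (EE_mono (bw_nonneg hq0 hq1) fun B => hG ?_)
    · intro k; have := hy k; positivity
    · have : Zf y (q/2) (fun k => F k && B k) = Zf (fun k => y k * (if F k then 1 else 0)) q B +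
          Zf (fun k => q * y k) (1/2) F := by
        simp only [Zf, ← Finset.sum_add_distrib]
        refine Finset.sum_congr rfl fun k _ => ?_
        rcases Bool.eq_false_or_eq_true (F k) with h | h <;>
          rcases Bool.eq_false_or_eq_true (B k) with h' | h' <;> simp [h, h'] <;> ring
      rw [this]; linarith
  · exact EE_nonneg (bw_nonneg hq0 hq1) fun _ => hG0 _

lemma EE_pow {G : ℝ → ℝ} (hG : Monotone G) (hG0 : ∀ z, 0 ≤ G z) {c : ℝ} (hc : 0 ≤ c)
    (hs : ∀ z, 2 * c ≤ G z + G (-z)) (j : ℕ) (y : ι → ℝ) (hy : ∀ k, 0 ≤ y k) :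
    c * (1/2)^j ≤ EE (bw ((1/2)^(j+1))) (fun B => G (Zf y ((1/2)^(j+1)) B)) := by
  induction j generalizing y with
  | zero => simpa using EE_symm G c hs y
  | succ j ih =>
    have := EE_half hG hG0 (c := c * (1/2)^j) (q := (1/2)^(j+1)) (by positivity) (by positivity)
      (pow_le_one₀ (by norm_num) (by norm_num)) ih y hy
    have e : ((1:ℝ)/2)^(j+1)/2 = (1/2)^(j+1+1) := by ring
    have e' : c * (1/2)^j/2 = c * (1/2)^(j+1) := by ring
    rw [e, e'] at this
    exact this

end bern

noncomputable def gA (z : ℝ) : ℝ := if z < 0 then Real.exp z else 2 / (1 + Real.exp (-z))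
noncomputable def gB (z : ℝ) : ℝ := min 1 (Real.exp z)

lemma gA_nonneg (z : ℝ) : 0 ≤ gA z := by unfold gA; split_ifs <;> positivity
lemma gB_nonneg (z : ℝ) : 0 ≤ gB z := by unfold gB; positivity
lemma gB_mono : Monotone gB := fun _ _ h => min_le_min le_rfl (Real.exp_le_exp.2 h)
lemma gA_mono : Monotone gA := by
  intro a b h
  unfold gA
  split_ifs with h1 h2 h2
  · exact Real.exp_le_exp.2 h
  · have e1 : Real.exp a ≤ 1 := Real.exp_le_one_iff.2 h1.le
    have e2 : Real.exp (-b) ≤ 1 := Real.exp_le_one_iff.2 (by linarith)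
    refine e1.trans ?_
    rw [le_div_iff₀ (by positivity)]; linarith
  · linarith
  · have : Real.exp (-b) ≤ Real.exp (-a) := Real.exp_le_exp.2 (by linarith)
    gcongr

lemma gB_symm (z : ℝ) : 2 * (1/2 : ℝ) ≤ gB z + gB (-z) := by
  unfold gB
  have p1 := Real.exp_pos z
  have p2 := Real.exp_pos (-z)
  rcases le_total 0 z with h | h
  · rw [min_eq_left (Real.one_le_exp h)]; have : 0 ≤ min 1 (Real.exp (-z)) := by positivity
    linarith
  · rw [min_eq_left (Real.one_le_exp (x := -z) (by linarith))]
    have : 0 ≤ min 1 (Real.exp z) := by positivity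
    linarith

lemma gA_aux {t : ℝ} (ht : 0 < t) : 2 * (914/1000 : ℝ) ≤ 2 / (1 + t) + t := by
  have : 2 / (1 + t) + t = (2 + t * (1 + t)) / (1 + t) := by field_simp
  rw [this, le_div_iff₀ (by positivity)]
  nlinarith [sq_nonneg (t - 414/1000)]

lemma gA_symm (z : ℝ) : 2 * (914/1000 : ℝ) ≤ gA z + gA (-z) := by
  unfold gA
  rcases lt_trichotomy z 0 with h | h | h
  · rw [if_pos h, if_neg (by linarith), neg_neg]
    linarith [gA_aux (Real.exp_pos z)]
  · subst h; norm_num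
  · rw [if_neg (by linarith), if_pos (by linarith)]
    exact gA_aux (Real.exp_pos (-z))

/-! ### Scalar lemmas -/

noncomputable def ell (X ρ p : ℝ) : ℝ := Real.log (1 + p * (Real.exp (X * ρ) - 1)) / X

lemma log_jensen {X l p : ℝ} (hX : 0 < X) (hl0 : 0 ≤ l) (hl1 : l ≤ 1) (hp0 : 0 ≤ p) (hp1 : p ≤ 1) :
    Real.log (1 + p * (Real.exp (X * l) - 1)) ≤ l * Real.log (1 + p * (Real.exp X - 1)) := by
  have hc := Real.concaveOn_rpow hl0 hl1
  have he : 1 ≤ Real.exp X := Real.one_le_exp hX.le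
  have he' : 1 ≤ Real.exp (X * l) := Real.one_le_exp (by positivity)
  have h := hc.2 (x := 1) (y := Real.exp X) (by simp) (Real.exp_pos X).le
    (sub_nonneg.2 hp1) hp0 (by ring)
  simp only [smul_eq_mul, Real.one_rpow, mul_one] at h
  rw [← Real.exp_mul] at h
  have h1 : 0 < 1 + p * (Real.exp X - 1) := by nlinarith
  have h2 : 0 < 1 + p * (Real.exp (X * l) - 1) := by nlinarith
  rw [← Real.log_rpow h1]
  apply Real.log_le_log h2
  have e : 1 - p + p * Real.exp X = 1 + p * (Real.exp X - 1) := by ring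
  rw [e] at h
  linarith

lemma ell_le_mul {X r p : ℝ} (hX : 0 < X) (hl0 : 0 ≤ r) (hl1 : r ≤ 1) (hp0 : 0 ≤ p) (hp1 : p ≤ 1) :
    ell X r p ≤ r * ell X 1 p := by
  unfold ell
  rw [← mul_div_assoc, mul_one]
  exact div_le_div_of_nonneg_right (log_jensen hX hl0 hl1 hp0 hp1) hX.le

lemma ell_nonneg {X r p : ℝ} (hX : 0 < X) (hl0 : 0 ≤ r) (hp0 : 0 ≤ p) : 0 ≤ ell X r p := by
  unfold ell
  have he' : 1 ≤ Real.exp (X * r) := Real.one_le_exp (by positivity)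
  apply div_nonneg (Real.log_nonneg _) hX.le
  nlinarith

lemma ell_le_one {X r p : ℝ} (hX : 0 < X) (hl0 : 0 ≤ r) (hl1 : r ≤ 1) (hp0 : 0 ≤ p) (hp1 : p ≤ 1) :
    ell X r p ≤ ell X 1 p := by
  have := ell_le_mul hX hl0 hl1 hp0 hp1
  have := ell_nonneg (r := 1) hX (by norm_num) hp0
  nlinarith

lemma ell_mono {X Y p : ℝ} (hX : 0 < X) (hXY : X ≤ Y) (hp0 : 0 ≤ p) (hp1 : p ≤ 1) :
    ell X 1 p ≤ ell Y 1 p := by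
  have hY : 0 < Y := by linarith
  have h := log_jensen (X := Y) (l := X / Y) hY (by positivity) ((div_le_one hY).2 hXY) hp0 hp1
  rw [mul_div_cancel₀ _ hY.ne'] at h
  unfold ell
  simp only [mul_one]
  rw [div_le_div_iff₀ hX hY]
  calc _ ≤ X / Y * Real.log (1 + p * (Real.exp Y - 1)) * Y := by gcongr
    _ = _ := by field_simp

lemma ell_conc {X r p z : ℝ} (hX : 0 < X) (hl0 : 0 ≤ r) (hp0 : 0 ≤ p)
    (hz0 : 0 ≤ z) (hz1 : z ≤ 1) : z * ell X r p ≤ ell X r (z * p) := by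
  unfold ell
  have he' : 1 ≤ Real.exp (X * r) := Real.one_le_exp (by positivity)
  have hu : 0 ≤ p * (Real.exp (X * r) - 1) := mul_nonneg hp0 (by linarith)
  have h := strictConcaveOn_log_Ioi.concaveOn.2 (x := 1)
    (y := 1 + p * (Real.exp (X * r) - 1)) (by simp) (by simp; linarith)
    (sub_nonneg.2 hz1) hz0 (by ring)
  simp only [smul_eq_mul, Real.log_one, mul_zero, zero_add, mul_one] at h
  rw [← mul_div_assoc]
  apply div_le_div_of_nonneg_right _ hX.le
  have e : 1 - z + z * (1 + p * (Real.exp (X * r) - 1)) = 1 + z * p * (Real.exp (X * r) - 1) := by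
    ring
  rw [e] at h
  exact h

lemma ell_le_lin {X r p : ℝ} (hX : 0 < X) (hl0 : 0 ≤ r) (hp0 : 0 ≤ p) :
    ell X r p ≤ p * ((Real.exp (X * r) - 1) / X) := by
  unfold ell
  have he' : 1 ≤ Real.exp (X * r) := Real.one_le_exp (by positivity)
  rw [← mul_div_assoc]
  apply div_le_div_of_nonneg_right _ hX.le
  have := Real.log_le_sub_one_of_pos (x := 1 + p * (Real.exp (X * r) - 1)) (by nlinarith)
  linarith

lemma ell_one_le {X p : ℝ} (hX : 0 < X) (hp0 : 0 ≤ p) (hp1 : p ≤ 1) : ell X 1 p ≤ 1 := by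
  unfold ell
  have he' : 1 ≤ Real.exp X := Real.one_le_exp hX.le
  rw [div_le_one hX, mul_one, Real.log_le_iff_le_exp (by nlinarith)]
  nlinarith

lemma final_pt {X A1 A2 p : ℝ} (hX : 0 < X) (h1 : 0 ≤ A1) (h2 : 0 ≤ A2) (hp0 : 0 ≤ p) (hp1 : p ≤ 1)
    (hG : (Real.exp X - 1) / X ≤ A1 + A2)
    (hor : 2 ≤ A1 + A2 ∨ 1 ≤ A1 / 2 + A2 / ((Real.exp X - 1) / X)) :
    ell X 1 p ≤ A1 * min p (1/2) + A2 * p := by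
  have a := ell_le_lin (r := 1) hX zero_le_one hp0
  have b := ell_one_le hX hp0 hp1
  rw [mul_one] at a
  have hGp : 0 < (Real.exp X - 1) / X := by
    have := Real.add_one_lt_exp hX.ne'
    apply div_pos _ hX; linarith
  set G := (Real.exp X - 1) / X
  rcases le_total p (1/2) with h | h
  · rw [min_eq_left h]; nlinarith
  · rw [min_eq_right h]
    rcases hor with h' | h'
    · nlinarith
    · rcases le_total (G * p) 1 with hg | hg
      · -- linear interpolation
        have e : A2 / G * G = A2 := by field_simp
        set D := A2 / G
        have : p * G ≤ A1 * (1/2) + D * G * p := by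
          rw [← e] at hG
          rcases le_total D 1 with hD | hD
          · nlinarith [mul_nonneg (sub_nonneg.2 hg) (sub_nonneg.2 hD)]
          · have : 0 ≤ (D - 1) * (G * p) := by
              apply mul_nonneg <;> [linarith; positivity]
            nlinarith
        rw [e] at this
        linarith
      · have : A2 / G ≤ A2 * p := by
          rw [div_le_iff₀ hGp]; nlinarith
        linarith

lemma pt_bound {x C ρ κ wf W z : ℝ} (hρ0 : 0 ≤ ρ) (hρ1 : ρ ≤ 1) (hC : 0 ≤ C) (hCx : C ≤ x)
    (hκ0 : 0 ≤ κ) (hκ1 : κ ≤ C) (hwf : 0 < wf) (hW : 0 ≤ W) :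
    ρ * ((1 + x - C) * (min (wf / (wf + W)) (1/2) * gA z) + C * (wf / (wf + W) * gB z)) ≤
      (ρ + x) * (wf * Real.exp z / (wf * Real.exp z + W)) +
        κ * (wf / (wf + W) - wf * Real.exp z / (wf * Real.exp z + W)) := by
  have hez := Real.exp_pos z
  have hp0 : 0 < wf / (wf + W) := by positivity
  have hp1 : wf / (wf + W) ≤ 1 := by rw [div_le_one (by positivity)]; linarith
  have hP0 : 0 < wf * Real.exp z / (wf * Real.exp z + W) := by positivity
  rcases lt_or_ge z 0 with hz | hz
  · have hez1 : Real.exp z ≤ 1 := Real.exp_le_one_iff.2 hz.le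
    have e1 : gA z = Real.exp z := by simp [gA, hz]
    have e2 : gB z = Real.exp z := by simp [gB, hz.le]
    rw [e1, e2]
    have hPp : wf * Real.exp z / (wf * Real.exp z + W) ≤ wf / (wf + W) := by
      rw [div_le_div_iff₀ (by positivity) (by positivity)]
      nlinarith [mul_nonneg (mul_nonneg hwf.le hW) (sub_nonneg.2 hez1)]
    have hPe : wf / (wf + W) * Real.exp z ≤ wf * Real.exp z / (wf * Real.exp z + W) := by
      rw [div_mul_eq_mul_div]
      apply div_le_div_of_nonneg_left (by positivity) (by positivity)
      nlinarith
    set p := wf / (wf + W)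
    set P := wf * Real.exp z / (wf * Real.exp z + W)
    have hm : min p (1/2) * Real.exp z ≤ P :=
      (mul_le_mul_of_nonneg_right (min_le_left _ _) hez.le).trans hPe
    have s1 : (1 + x - C) * (min p (1/2) * Real.exp z) ≤ (1 + x - C) * P :=
      mul_le_mul_of_nonneg_left hm (by linarith)
    have s2 : C * (p * Real.exp z) ≤ C * P := mul_le_mul_of_nonneg_left hPe hC
    have s3 : 0 ≤ κ * (p - P) := mul_nonneg hκ0 (by linarith)
    have s4 := mul_le_mul_of_nonneg_left (add_le_add s1 s2) hρ0
    have s5 : ρ * ((1 + x) * P) ≤ (ρ + x) * P := by nlinarith [mul_nonneg (hC.trans hCx) hP0.le]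
    nlinarith
  · have hez1 : 1 ≤ Real.exp z := Real.one_le_exp hz
    have e1 : gA z = 2 / (1 + Real.exp (-z)) := by simp [gA, not_lt.2 hz]
    have e2 : gB z = 1 := by simp [gB, hz]
    have hPp : wf / (wf + W) ≤ wf * Real.exp z / (wf * Real.exp z + W) := by
      rw [div_le_div_iff₀ (by positivity) (by positivity)]
      nlinarith [mul_nonneg (mul_nonneg hwf.le hW) (sub_nonneg.2 hez1)]
    have hm : min (wf / (wf + W)) (1/2) * gA z ≤ wf * Real.exp z / (wf * Real.exp z + W) := by
      rw [e1, Real.exp_neg]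
      have e3 : 2 / (1 + (Real.exp z)⁻¹) = 2 * Real.exp z / (Real.exp z + 1) := by
        field_simp
      rw [e3]
      rcases le_total wf W with h | h
      · refine (mul_le_mul_of_nonneg_right (min_le_left _ _) (by positivity)).trans ?_
        rw [div_mul_div_comm, div_le_div_iff₀ (by positivity) (by positivity)]
        have : 0 ≤ wf * Real.exp z * ((W - wf) * (Real.exp z - 1)) := by
          have := sub_nonneg.2 h
          have := sub_nonneg.2 hez1
          positivity
        nlinarith
      · refine (mul_le_mul_of_nonneg_right (min_le_right _ _) (by positivity)).trans ?_
        rw [div_mul_div_comm, div_le_div_iff₀ (by positivity) (by positivity)]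
        nlinarith [mul_le_mul_of_nonneg_left h hez.le]
    rw [e2]
    set p := wf / (wf + W)
    set P := wf * Real.exp z / (wf * Real.exp z + W)
    have s1 : (1 + x - C) * (min p (1/2) * gA z) ≤ (1 + x - C) * P :=
      mul_le_mul_of_nonneg_left hm (by linarith)
    have s3 : C * (p - P) ≤ κ * (p - P) := mul_le_mul_of_nonpos_right hκ1 (by linarith)
    have s4 := mul_le_mul_of_nonneg_left s1 hρ0
    have s5 : ρ * ((1 + x - C) * P) ≤ (ρ + x - C) * P := by
      nlinarith [mul_nonneg (mul_nonneg (sub_nonneg.2 hρ1) (sub_nonneg.2 hCx)) hP0.le]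
    have s6 : ρ * (C * p) ≤ C * p := by nlinarith [mul_nonneg hC hp0.le]
    nlinarith

lemma key_corr {ι : Type*} [Fintype ι] [DecidableEq ι] (j : ℕ) (y : ι → ℝ) (hy : ∀ k, 0 ≤ y k)
    {x C ρ X wf : ℝ} (hρ0 : 0 ≤ ρ) (hρ1 : ρ ≤ 1) (hC : 0 ≤ C) (hCx : C ≤ x) (hX : 0 < X)
    (hwf : 0 < wf) (W κ : (ι → Bool) → ℝ) (hW : ∀ B, 0 ≤ W B) (hWa : Antitone W)
    (hκ0 : ∀ B, 0 ≤ κ B) (hκ1 : ∀ B, κ B ≤ C)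
    (H : ∀ p, 0 ≤ p → p ≤ 1 → ell X 1 p ≤
      (914/1000 * (1/2)^j * (1 + x - C)) * min p (1/2) + (C * (1/2 * (1/2)^j)) * p) :
    0 ≤ EE (bw ((1/2)^(j+1))) (fun B =>
      (ρ + x) * (wf * Real.exp (Zf y ((1/2)^(j+1)) B) /
          (wf * Real.exp (Zf y ((1/2)^(j+1)) B) + W B)) +
        κ B * (wf / (wf + W B) - wf * Real.exp (Zf y ((1/2)^(j+1)) B) /
          (wf * Real.exp (Zf y ((1/2)^(j+1)) B) + W B)) - ell X ρ (wf / (wf + W B))) := by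
  set q : ℝ := (1/2)^(j+1) with hq
  have hq0 : 0 ≤ q := by positivity
  have hq1 : q ≤ 1 := pow_le_one₀ (by norm_num) (by norm_num)
  have hbw := bw_nonneg hq0 hq1
  have hA := EE_pow gA_mono gA_nonneg (c := 914/1000) (by norm_num) gA_symm j y hy
  have hB := EE_pow gB_mono gB_nonneg (c := 1/2) (by norm_num) gB_symm j y hy
  rw [← hq] at hA hB
  have hp0 : ∀ B, 0 ≤ wf / (wf + W B) := fun B => by have := hW B; positivity
  have hp1 : ∀ B, wf / (wf + W B) ≤ 1 := fun B => by
    have := hW B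
    rw [div_le_one (by positivity)]; linarith
  have hpm : Monotone (fun B => wf / (wf + W B)) := by
    intro a b h
    have := hWa h
    have := hW b
    apply div_le_div_of_nonneg_left hwf.le (by positivity); linarith
  have hsm : Monotone (fun B => min (wf / (wf + W B)) (1/2)) := fun a b h =>
    min_le_min (hpm h) le_rfl
  have hs0 : ∀ B, 0 ≤ min (wf / (wf + W B)) (1/2) := fun B => le_min (hp0 B) (by norm_num)
  have f1 := harris hq0 hq1 hs0 (fun B => gA_nonneg (Zf y q B)) hsm (gA_mono.comp (Zf_mono hy q))
  have f2 := harris hq0 hq1 hp0 (fun B => gB_nonneg (Zf y q B)) hpm (gB_mono.comp (Zf_mono hy q))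
  have g1 := EE_mono (ι := ι) hbw (fun B => H _ (hp0 B) (hp1 B))
  rw [EE_add, EE_mul, EE_mul] at g1
  have n1 := EE_nonneg hbw hs0
  have n2 := EE_nonneg hbw hp0
  have f1' := (mul_le_mul_of_nonneg_left hA n1).trans f1
  have f2' := (mul_le_mul_of_nonneg_left hB n2).trans f2
  have f1'' := mul_le_mul_of_nonneg_left f1' (a := 1 + x - C) (by linarith)
  have f2'' := mul_le_mul_of_nonneg_left f2' hC
  have main : 0 ≤ EE (bw q) (fun B => ρ * (((1 + x - C) *
      (min (wf / (wf + W B)) (1/2) * gA (Zf y q B)) +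
      C * (wf / (wf + W B) * gB (Zf y q B))) - ell X 1 (wf / (wf + W B)))) := by
    rw [EE_mul, EE_sub, EE_add, EE_mul, EE_mul]
    apply mul_nonneg hρ0
    have : (fun B => gA (Zf y q B)) = gA ∘ Zf y q := rfl
    nlinarith
  refine main.trans (EE_mono hbw fun B => ?_)
  have a := pt_bound (z := Zf y q B) hρ0 hρ1 hC hCx (hκ0 B) (hκ1 B) hwf (hW B)
  have b := ell_le_mul hX hρ0 hρ1 (hp0 B) (hp1 B)
  linarith

/-! ### Numerics -/

lemma exp_ub {a U : ℝ} (ha0 : 0 ≤ a) (ha1 : a ≤ 4)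
    (h : (1 + a/4 + (a/4)^2/2 + (a/4)^3/6 + (a/4)^4/24 + (a/4)^5/120 + (a/4)^6/720
      + (a/4)^7 * 8 / (5040 * 7)) ^ 4 ≤ U) : Real.exp a ≤ U := by
  have := Real.exp_bound' (x := a/4) (by positivity) (by linarith) (n := 7) (by norm_num)
  simp only [Finset.sum_range_succ, Nat.factorial] at this
  norm_num at this
  have e : Real.exp a = Real.exp (a/4) ^ 4 := by rw [← Real.exp_nat_mul]; congr 1; push_cast; ring
  rw [e]
  refine le_trans (pow_le_pow_left₀ (Real.exp_pos _).le (this.trans ?_) 4) h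
  apply le_of_eq; ring

lemma exp_neg_ub {s u : ℝ} (hs : 0 ≤ s) (hu : 0 < u)
    (h : 1 ≤ u * (1 + s + s^2/2 + s^3/6 + s^4/24 + s^5/120 + s^6/720)) : Real.exp (-s) ≤ u := by
  have := Real.sum_le_exp_of_nonneg hs 7
  simp only [Finset.sum_range_succ, Nat.factorial] at this
  norm_num at this
  rw [Real.exp_neg, inv_le_iff_one_le_mul₀ (Real.exp_pos s)]
  refine h.trans (mul_le_mul_of_nonneg_left ?_ hu.le)
  linarith

lemma exp_chord {a b x A B : ℝ} (hax : a ≤ x) (hxb : x ≤ b) (hab : a < b)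
    (hA : Real.exp a ≤ A) (hB : Real.exp b ≤ B) :
    (b - a) * Real.exp x ≤ (b - x) * A + (x - a) * B := by
  have hba : 0 < b - a := by linarith
  have h := convexOn_exp.2 (x := a) (y := b) (by simp) (by simp)
    (show 0 ≤ (b - x) / (b - a) from div_nonneg (by linarith) hba.le)
    (show 0 ≤ (x - a) / (b - a) from div_nonneg (by linarith) hba.le) (by field_simp; ring)
  simp only [smul_eq_mul] at h
  have e : (b - x) / (b - a) * a + (x - a) / (b - a) * b = x := by field_simp; ring
  rw [e] at h
  have h2 := mul_le_mul_of_nonneg_left h hba.le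
  have e2 : (b - a) * ((b - x) / (b - a) * Real.exp a + (x - a) / (b - a) * Real.exp b) =
    (b - x) * Real.exp a + (x - a) * Real.exp b := by field_simp
  rw [e2] at h2
  have := mul_le_mul_of_nonneg_left hA (a := b - x) (by linarith)
  have := mul_le_mul_of_nonneg_left hB (a := x - a) (by linarith)
  linarith

lemma exp_quad {x : ℝ} (h0 : 0 ≤ x) (h1 : x ≤ 179/100) : Real.exp x ≤ 1 + x + x^2 := by
  have e1 : Real.exp 1 ≤ 27183/10000 := exp_ub (by norm_num) (by norm_num) (by norm_num)
  have e2 : Real.exp (3/2) ≤ 44818/10000 := exp_ub (by norm_num) (by norm_num) (by norm_num)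
  have e3 : Real.exp (179/100) ≤ 5990/1000 := exp_ub (by norm_num) (by norm_num) (by norm_num)
  rcases le_total x 1 with h | h
  · have := Real.abs_exp_sub_one_sub_id_le (x := x) (by rw [abs_of_nonneg h0]; exact h)
    have := le_abs_self (Real.exp x - 1 - x)
    linarith
  · rcases le_total x (3/2) with h' | h'
    · have := exp_chord h h' (by norm_num) e1 e2
      nlinarith
    · have := exp_chord h' h1 (by norm_num) e2 e3
      nlinarith

/-- `(e^{xρ} - 1)/x ≤ ρ (e^x-1)/x`. -/
lemma exp_rho {x ρ : ℝ} (hρ0 : 0 ≤ ρ) (hρ1 : ρ ≤ 1) :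
    Real.exp (x * ρ) - 1 ≤ ρ * (Real.exp x - 1) := by
  have h := convexOn_exp.2 (x := 0) (y := x) (by simp) (by simp)
    (sub_nonneg.2 hρ1) hρ0 (by ring)
  simp only [smul_eq_mul, mul_zero, zero_add, Real.exp_zero, mul_one] at h
  rw [mul_comm x ρ]
  linarith

lemma G_mono {x θ : ℝ} (hx : 0 < x) (h : x ≤ θ) :
    (Real.exp x - 1) / x ≤ (Real.exp θ - 1) / θ := by
  have hθ : 0 < θ := by linarith
  have := exp_rho (x := θ) (ρ := x / θ) (by positivity) ((div_le_one hθ).2 h)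
  rw [mul_div_cancel₀ _ hθ.ne'] at this
  rw [div_le_div_iff₀ hx hθ]
  calc _ ≤ x / θ * (Real.exp θ - 1) * θ := by gcongr
    _ = _ := by field_simp

lemma n2_check {θ X Y h s u E T p : ℝ} (hX : 0 < X) (hXY : X ≤ Y) (hθ : 0 < θ)
    (hE : Real.exp Y ≤ E) (hu : Real.exp (-s) ≤ u) (hT : Real.exp θ ≤ T)
    (c0 : (T - 1) / θ + (s + u - 1) / Y ≤ h) (c1 : (s + E * u - 1) / Y ≤ h)
    (hp0 : 0 ≤ p) (hp1 : p ≤ 1) :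
    (1 - p) * ((Real.exp θ - 1) / θ) + ell X 1 p ≤ h := by
  have hY : 0 < Y := by linarith
  have a := ell_mono hX hXY hp0 hp1
  have hG : (Real.exp θ - 1) / θ ≤ (T - 1) / θ := by gcongr
  have he : 1 ≤ Real.exp Y := Real.one_le_exp hY.le
  have hv : 0 < 1 + p * (Real.exp Y - 1) := by nlinarith
  have hl : Real.log (1 + p * (Real.exp Y - 1)) ≤ s + (1 + p * (E - 1)) * u - 1 := by
    have h1 := Real.log_le_sub_one_of_pos (x := (1 + p * (Real.exp Y - 1)) * Real.exp (-s))
      (by positivity)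
    rw [Real.log_mul hv.ne' (Real.exp_pos _).ne', Real.log_exp] at h1
    have h2 : (1 + p * (Real.exp Y - 1)) * Real.exp (-s) ≤ (1 + p * (E - 1)) * u := by
      apply mul_le_mul _ hu (Real.exp_pos _).le
      · nlinarith
      · nlinarith
    linarith
  have b : ell Y 1 p ≤ (s + (1 + p * (E - 1)) * u - 1) / Y := by
    unfold ell
    rw [mul_one]
    gcongr
  have e : (s + (1 + p * (E - 1)) * u - 1) / Y = (1 - p) * ((s + u - 1) / Y) +
    p * ((s + E * u - 1) / Y) := by field_simp; ring
  have c := mul_le_mul_of_nonneg_left hG (sub_nonneg.2 hp1)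
  have d0 := mul_le_mul_of_nonneg_left c0 (sub_nonneg.2 hp1)
  have d1 := mul_le_mul_of_nonneg_left c1 hp0
  rw [e] at b
  linarith

noncomputable def kf (x θ g h : ℝ) : ℝ := if x ≤ θ then g else h

lemma kf_pos {x θ g h : ℝ} (hx : x ≤ θ) : kf x θ g h = g := if_pos hx
lemma kf_neg {x θ g h : ℝ} (hx : ¬ x ≤ θ) : kf x θ g h = h := if_neg hx

structure NuOK {I : Type} [Fintype I] (m θ h : I → ℝ) (X C : ℝ) : Prop where
  m0 : ∀ i, 0 ≤ m i
  m1 : ∑ i, m i = 1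
  θ0 : ∀ i, 0 < θ i
  n2 : ∀ i p, 0 ≤ p → p ≤ 1 → (1 - p) * ((Real.exp (θ i) - 1) / θ i) + ell X 1 p ≤ h i
  n3 : ∀ x ρ, 0 < x → 0 ≤ ρ → ρ ≤ 1 →
    ∑ i, m i * kf x (θ i) ((Real.exp (x * ρ) - 1) / x) (h i) ≤ ρ + x
  n4 : ∑ i, m i * h i ≤ C

lemma nuA {X : ℝ} (hX : 0 < X) (hX2 : X ≤ 23/10) :
    NuOK ![38/100, 255/1000, 22/100, 145/1000] ![6/10, 11/10, 17/10, 23/10]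
      ![155/100, 193/100, 267/100, 391/100] X (224/100) := by
  have e1 : Real.exp (6/10) ≤ 18222/10000 := exp_ub (by norm_num) (by norm_num) (by norm_num)
  have e2 : Real.exp (11/10) ≤ 30042/10000 := exp_ub (by norm_num) (by norm_num) (by norm_num)
  have e3 : Real.exp (17/10) ≤ 54740/10000 := exp_ub (by norm_num) (by norm_num) (by norm_num)
  have e4 : Real.exp (23/10) ≤ 9975/1000 := exp_ub (by norm_num) (by norm_num) (by norm_num)
  have s1 : Real.exp (-(105/100)) ≤ 3501/10000 := exp_neg_ub (by norm_num) (by norm_num) (by norm_num)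
  have s2 : Real.exp (-(76/100)) ≤ 4677/10000 := exp_neg_ub (by norm_num) (by norm_num) (by norm_num)
  have s3 : Real.exp (-(394/1000)) ≤ 6744/10000 := exp_neg_ub (by norm_num) (by norm_num) (by norm_num)
  refine ⟨?_, ?_, ?_, ?_, ?_, ?_⟩
  · intro i; fin_cases i <;> norm_num
  · simp [Fin.sum_univ_four]; norm_num
  · intro i; fin_cases i <;> norm_num
  · intro i p hp0 hp1
    fin_cases i
    · exact n2_check hX hX2 (by norm_num) e4 s1 e1 (by norm_num) (by norm_num) hp0 hp1
    · exact n2_check hX hX2 (by norm_num) e4 s2 e2 (by norm_num) (by norm_num) hp0 hp1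
    · exact n2_check hX hX2 (by norm_num) e4 s3 e3 (by norm_num) (by norm_num) hp0 hp1
    · exact n2_check hX hX2 (by norm_num) e4 (s := 0) (u := 1) (by simp) e4 (by norm_num)
        (by norm_num) hp0 hp1
  · intro x ρ hx hρ0 hρ1
    have g0 : (Real.exp (x * ρ) - 1) / x ≤ ρ * ((Real.exp x - 1) / x) := by
      rw [← mul_div_assoc]; exact div_le_div_of_nonneg_right (exp_rho hρ0 hρ1) hx.le
    have g1 : x ≤ 179/100 → (Real.exp x - 1) / x ≤ 1 + x := by
      intro h
      rw [div_le_iff₀ hx]; nlinarith [exp_quad hx.le h]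
    have g2 : x ≤ 23/10 → (Real.exp x - 1) / x ≤ 391/100 := by
      intro h
      refine (G_mono hx h).trans ?_
      rw [div_le_iff₀ (by norm_num)]; linarith
    simp only [Fin.sum_univ_four]
    simp only [Matrix.cons_val]
    set g := (Real.exp (x * ρ) - 1) / x
    set G := (Real.exp x - 1) / x
    have t1 : ρ * x ≤ x := by nlinarith
    by_cases c1 : x ≤ 6/10
    · rw [kf_pos c1,
        kf_pos (c1.trans (by norm_num : (6/10:ℝ) ≤ 11/10)),
        kf_pos (c1.trans (by norm_num : (6/10:ℝ) ≤ 17/10)),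
        kf_pos (c1.trans (by norm_num : (6/10:ℝ) ≤ 23/10))]
      nlinarith [g1 (by linarith)]
    by_cases c2 : x ≤ 11/10
    · rw [kf_neg c1,
        kf_pos c2,
        kf_pos (c2.trans (by norm_num : (11/10:ℝ) ≤ 17/10)),
        kf_pos (c2.trans (by norm_num : (11/10:ℝ) ≤ 23/10))]
      have := mul_le_mul_of_nonneg_left (g1 (by linarith)) hρ0
      push Not at c1
      nlinarith [mul_nonneg hρ0 (sub_nonneg.2 c1.le),
        mul_nonneg (sub_nonneg.2 hρ1) (sub_nonneg.2 c1.le)]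
    by_cases c3 : x ≤ 17/10
    · rw [kf_neg c1,
        kf_neg c2,
        kf_pos c3,
        kf_pos (c3.trans (by norm_num : (17/10:ℝ) ≤ 23/10))]
      have := mul_le_mul_of_nonneg_left (g1 (by linarith)) hρ0
      push Not at c2
      nlinarith [mul_nonneg hρ0 (sub_nonneg.2 c2.le),
        mul_nonneg (sub_nonneg.2 hρ1) (sub_nonneg.2 c2.le)]
    by_cases c4 : x ≤ 23/10
    · rw [kf_neg c1,
        kf_neg c2,
        kf_neg c3,
        kf_pos c4]
      have := mul_le_mul_of_nonneg_left (g2 (by linarith)) hρ0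
      linarith
    · rw [kf_neg c1,
        kf_neg c2,
        kf_neg c3,
        kf_neg c4]
      linarith
  · simp only [Fin.sum_univ_four, Matrix.cons_val]; norm_num

lemma nuB {X : ℝ} (hX : 0 < X) (hX2 : X ≤ 115/100) :
    NuOK ![235/1000, 21/100, 18/100, 15/100, 125/1000, 10/100]
      ![3/10, 6/10, 9/10, 12/10, 15/10, 179/100]
      ![126/100, 142/100, 164/100, 194/100, 233/100, 279/100] X (176/100) := by
  have e1 : Real.exp (3/10) ≤ 13499/10000 := exp_ub (by norm_num) (by norm_num) (by norm_num)
  have e2 : Real.exp (6/10) ≤ 18222/10000 := exp_ub (by norm_num) (by norm_num) (by norm_num)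
  have e3 : Real.exp (9/10) ≤ 24597/10000 := exp_ub (by norm_num) (by norm_num) (by norm_num)
  have e4 : Real.exp (12/10) ≤ 33202/10000 := exp_ub (by norm_num) (by norm_num) (by norm_num)
  have e5 : Real.exp (15/10) ≤ 44818/10000 := exp_ub (by norm_num) (by norm_num) (by norm_num)
  have e6 : Real.exp (179/100) ≤ 5990/1000 := exp_ub (by norm_num) (by norm_num) (by norm_num)
  have eX : Real.exp (115/100) ≤ 31583/10000 := exp_ub (by norm_num) (by norm_num) (by norm_num)
  have s1 : Real.exp (-(475/1000)) ≤ 6220/10000 := exp_neg_ub (by norm_num) (by norm_num) (by norm_num)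
  have s2 : Real.exp (-(315/1000)) ≤ 7299/10000 := exp_neg_ub (by norm_num) (by norm_num) (by norm_num)
  have s3 : Real.exp (-(145/1000)) ≤ 8651/10000 := exp_neg_ub (by norm_num) (by norm_num) (by norm_num)
  have s0 : Real.exp (-0) ≤ 1 := by simp
  refine ⟨?_, ?_, ?_, ?_, ?_, ?_⟩
  · intro i; fin_cases i <;> norm_num
  · simp [Fin.sum_univ_six]; norm_num
  · intro i; fin_cases i <;> norm_num
  · intro i p hp0 hp1
    fin_cases i
    · exact n2_check hX hX2 (by norm_num) eX s1 e1 (by norm_num) (by norm_num) hp0 hp1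
    · exact n2_check hX hX2 (by norm_num) eX s2 e2 (by norm_num) (by norm_num) hp0 hp1
    · exact n2_check hX hX2 (by norm_num) eX s3 e3 (by norm_num) (by norm_num) hp0 hp1
    · exact n2_check hX hX2 (by norm_num) eX s0 e4 (by norm_num) (by norm_num) hp0 hp1
    · exact n2_check hX hX2 (by norm_num) eX s0 e5 (by norm_num) (by norm_num) hp0 hp1
    · exact n2_check hX hX2 (by norm_num) eX s0 e6 (by norm_num) (by norm_num) hp0 hp1
  · intro x ρ hx hρ0 hρ1
    have g0 : (Real.exp (x * ρ) - 1) / x ≤ ρ * ((Real.exp x - 1) / x) := by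
      rw [← mul_div_assoc]; exact div_le_div_of_nonneg_right (exp_rho hρ0 hρ1) hx.le
    have g1 : x ≤ 179/100 → (Real.exp x - 1) / x ≤ 1 + x := by
      intro h
      rw [div_le_iff₀ hx]; nlinarith [exp_quad hx.le h]
    simp only [Fin.sum_univ_six]
    simp only [Matrix.cons_val]
    set g := (Real.exp (x * ρ) - 1) / x
    set G := (Real.exp x - 1) / x
    have t1 : ρ * x ≤ x := by nlinarith
    by_cases c1 : x ≤ 3/10
    · rw [kf_pos c1,
        kf_pos (c1.trans (by norm_num : (3/10:ℝ) ≤ 6/10)),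
        kf_pos (c1.trans (by norm_num : (3/10:ℝ) ≤ 9/10)),
        kf_pos (c1.trans (by norm_num : (3/10:ℝ) ≤ 12/10)),
        kf_pos (c1.trans (by norm_num : (3/10:ℝ) ≤ 15/10)),
        kf_pos (c1.trans (by norm_num : (3/10:ℝ) ≤ 179/100))]
      nlinarith [g1 (by linarith)]
    by_cases c2 : x ≤ 6/10
    · rw [kf_neg c1,
        kf_pos c2,
        kf_pos (c2.trans (by norm_num : (6/10:ℝ) ≤ 9/10)),
        kf_pos (c2.trans (by norm_num : (6/10:ℝ) ≤ 12/10)),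
        kf_pos (c2.trans (by norm_num : (6/10:ℝ) ≤ 15/10)),
        kf_pos (c2.trans (by norm_num : (6/10:ℝ) ≤ 179/100))]
      have := mul_le_mul_of_nonneg_left (g1 (by linarith)) hρ0
      push Not at c1
      nlinarith [mul_nonneg hρ0 (sub_nonneg.2 c1.le),
        mul_nonneg (sub_nonneg.2 hρ1) (sub_nonneg.2 c1.le)]
    by_cases c3 : x ≤ 9/10
    · rw [kf_neg c1,
        kf_neg c2,
        kf_pos c3,
        kf_pos (c3.trans (by norm_num : (9/10:ℝ) ≤ 12/10)),
        kf_pos (c3.trans (by norm_num : (9/10:ℝ) ≤ 15/10)),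
        kf_pos (c3.trans (by norm_num : (9/10:ℝ) ≤ 179/100))]
      have := mul_le_mul_of_nonneg_left (g1 (by linarith)) hρ0
      push Not at c2
      nlinarith [mul_nonneg hρ0 (sub_nonneg.2 c2.le),
        mul_nonneg (sub_nonneg.2 hρ1) (sub_nonneg.2 c2.le)]
    by_cases c4 : x ≤ 12/10
    · rw [kf_neg c1,
        kf_neg c2,
        kf_neg c3,
        kf_pos c4,
        kf_pos (c4.trans (by norm_num : (12/10:ℝ) ≤ 15/10)),
        kf_pos (c4.trans (by norm_num : (12/10:ℝ) ≤ 179/100))]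
      have := mul_le_mul_of_nonneg_left (g1 (by linarith)) hρ0
      push Not at c3
      nlinarith [mul_nonneg hρ0 (sub_nonneg.2 c3.le),
        mul_nonneg (sub_nonneg.2 hρ1) (sub_nonneg.2 c3.le)]
    by_cases c5 : x ≤ 15/10
    · rw [kf_neg c1,
        kf_neg c2,
        kf_neg c3,
        kf_neg c4,
        kf_pos c5,
        kf_pos (c5.trans (by norm_num : (15/10:ℝ) ≤ 179/100))]
      have := mul_le_mul_of_nonneg_left (g1 (by linarith)) hρ0
      push Not at c4
      nlinarith [mul_nonneg hρ0 (sub_nonneg.2 c4.le),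
        mul_nonneg (sub_nonneg.2 hρ1) (sub_nonneg.2 c4.le)]
    by_cases c6 : x ≤ 179/100
    · rw [kf_neg c1,
        kf_neg c2,
        kf_neg c3,
        kf_neg c4,
        kf_neg c5,
        kf_pos c6]
      have := mul_le_mul_of_nonneg_left (g1 (by linarith)) hρ0
      push Not at c5
      nlinarith [mul_nonneg hρ0 (sub_nonneg.2 c5.le),
        mul_nonneg (sub_nonneg.2 hρ1) (sub_nonneg.2 c5.le)]
    · rw [kf_neg c1,
        kf_neg c2,
        kf_neg c3,
        kf_neg c4,
        kf_neg c5,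
        kf_neg c6]
      linarith
  · simp only [Fin.sum_univ_six, Matrix.cons_val]; norm_num

/-- Range C: final scalar check. -/
lemma rangeC {X x : ℝ} (j : ℕ) (hx : X = (1/2)^(j+1) * x) (h1 : 115/100 ≤ X) (h2 : X ≤ 23/10)
    (hx2 : 23/10 ≤ x) (p : ℝ) (hp0 : 0 ≤ p) (hp1 : p ≤ 1) : ell X 1 p ≤
      (914/1000 * (1/2)^j * (1 + x - 224/100)) * min p (1/2) + (224/100 * (1/2 * (1/2)^j)) * p := by
  have hX : 0 < X := by linarith
  have e1 : Real.exp (115/100) ≤ 31583/10000 := exp_ub (by norm_num) (by norm_num) (by norm_num)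
  have e2 : Real.exp (16/10) ≤ 4954/1000 := exp_ub (by norm_num) (by norm_num) (by norm_num)
  have e3 : Real.exp (23/10) ≤ 9975/1000 := exp_ub (by norm_num) (by norm_num) (by norm_num)
  have hq1 : ((1:ℝ)/2)^j ≤ 1 := pow_le_one₀ (by norm_num) (by norm_num)
  have hq0 : (0:ℝ) < (1/2)^j := by positivity
  have hs : 18/10 * X - 2/100 ≤
      914/1000 * (1/2)^j * (1 + x - 224/100) + 224/100 * (1/2 * (1/2)^j) := by
    have : (1/2:ℝ)^j * x = 2 * X := by rw [hx]; ring
    nlinarith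
  have hE : Real.exp X ≤ 1 + X * (18/10 * X - 2/100) := by
    rcases le_total X (16/10) with h | h
    · have := exp_chord h1 h (by norm_num) e1 e2
      nlinarith
    · have := exp_chord h h2 (by norm_num) e2 e3
      nlinarith
  refine final_pt hX ?_ (by positivity) hp0 hp1 ?_ (Or.inl ?_)
  · apply mul_nonneg (by positivity); linarith
  · refine le_trans ?_ hs
    rw [div_le_iff₀ hX]; linarith
  · linarith

/-- Range B: final scalar check. -/
lemma rangeB {X x : ℝ} (hx : X = (1/2)^(0+1) * x) (h1 : 179/100 ≤ x) (h2 : x ≤ 23/10)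
    (p : ℝ) (hp0 : 0 ≤ p) (hp1 : p ≤ 1) : ell X 1 p ≤
      (914/1000 * (1/2)^0 * (1 + x - 176/100)) * min p (1/2) + (176/100 * (1/2 * (1/2)^0)) * p := by
  have hx' : x = 2 * X := by rw [hx]; ring
  subst hx'
  have hX : 0 < X := by linarith
  have e1 : Real.exp (895/1000) ≤ 24475/10000 := exp_ub (by norm_num) (by norm_num) (by norm_num)
  have e2 : Real.exp (115/100) ≤ 31583/10000 := exp_ub (by norm_num) (by norm_num) (by norm_num)
  have hc := exp_chord (x := X) (by linarith) (by linarith) (by norm_num) e1 e2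
  have hEX : 0 < Real.exp X - 1 := by
    have := Real.add_one_lt_exp hX.ne'; linarith
  refine final_pt hX ?_ (by positivity) hp0 hp1 ?_ (Or.inr ?_)
  · apply mul_nonneg (by positivity); linarith
  · rw [div_le_iff₀ hX]; nlinarith
  · rw [div_div_eq_mul_div]
    have : 1 - 914/1000 * (1/2)^0 * (1 + 2 * X - 176/100) / 2 ≤
        176/100 * (1/2 * (1/2)^0) * X / (Real.exp X - 1) := by
      rw [le_div_iff₀ hEX]
      nlinarith
    linarith

/-! ### The surrogate potential -/

noncomputable def bi (b : Bool) : ℝ := if b then 1 else 0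

lemma bi_nonneg (b : Bool) : 0 ≤ bi b := by cases b <;> simp [bi]

lemma exp_bi (y : ℝ) (b : Bool) : Real.exp (y * bi b) - 1 = bi b * (Real.exp y - 1) := by
  cases b <;> simp [bi]

lemma log_bi (y p : ℝ) (b : Bool) : Real.log (1 + p * (Real.exp (y * bi b) - 1)) =
    bi b * Real.log (1 + p * (Real.exp y - 1)) := by
  cases b <;> simp [bi]

noncomputable def hs {n : ℕ} {α : Type*} (f : ℕ → α → ℝ) (t : ℕ) (s : Fin n → α) : ℝ :=
  ∑ k : Fin n, if k.val < t then f k (s k) else 0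

lemma hs_zero {n : ℕ} {α : Type*} (f : ℕ → α → ℝ) (s : Fin n → α) : hs f 0 s = 0 := by
  simp [hs]

lemma hs_succ {n : ℕ} {α : Type*} (f : ℕ → α → ℝ) (t : ℕ) (ht : t < n) (s : Fin n → α) (a : α) :
    hs f (t + 1) (Function.update s ⟨t, ht⟩ a) = hs f t s + f t a := by
  unfold hs
  have : f t a = ∑ k : Fin n, if k = ⟨t, ht⟩ then f t a else 0 := by simp
  rw [this, ← Finset.sum_add_distrib]
  refine Finset.sum_congr rfl fun k _ => ?_
  by_cases hk : k = ⟨t, ht⟩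
  · subst hk; simp
  · have hk' : k.val ≠ t := fun h => hk (Fin.ext h)
    rw [Function.update_of_ne hk, if_neg hk, add_zero]
    by_cases h : k.val < t
    · rw [if_pos h, if_pos (by omega)]
    · rw [if_neg h, if_neg (by omega)]

section scalar
variable {B : Type*} [Fintype B]

lemma step_log (wf X r : ℝ) (c : Bool) (hwf : 0 < wf) (hX : 0 < X) (hr : 0 ≤ r) (u y : B → ℝ)
    (hu : ∀ b, 0 ≤ u b) (hy : ∀ b, 0 ≤ y b) (J : B → Bool) :
    Real.log (wf * Real.exp (X * r * bi c) + ∑ b, u b * Real.exp (y b * bi (J b))) -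
      Real.log (wf * Real.exp (X * r * bi c)) ≤
    Real.log (wf + ∑ b, u b) - Real.log wf - X * r * bi c +
      bi c * (X * ell X r (wf / (wf + ∑ b, u b))) +
      (∑ b, u b * (bi (J b) * (Real.exp (y b) - 1))) / (wf + ∑ b, u b) := by
  set U := ∑ b, u b with hU
  have hU0 : 0 ≤ U := Finset.sum_nonneg fun b _ => hu b
  set p := wf / (wf + U) with hp
  have hp0 : 0 ≤ p := by positivity
  set e := Real.exp (X * r * bi c) with he
  have he1 : 1 ≤ e := Real.one_le_exp (by have := bi_nonneg c; positivity)
  set Q := (∑ b, u b * (bi (J b) * (Real.exp (y b) - 1))) / (wf + U) with hQ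
  have hQ0 : 0 ≤ Q := by
    apply div_nonneg _ (by positivity)
    refine Finset.sum_nonneg fun b _ => mul_nonneg (hu b) (mul_nonneg (bi_nonneg _) ?_)
    have := Real.one_le_exp (hy b)
    linarith
  have e1 : wf * e + ∑ b, u b * Real.exp (y b * bi (J b)) =
      (wf + U) * (1 + p * (e - 1) + Q) := by
    have : ∑ b, u b * Real.exp (y b * bi (J b)) = U +
        ∑ b, u b * (bi (J b) * (Real.exp (y b) - 1)) := by
      rw [hU, ← Finset.sum_add_distrib]
      refine Finset.sum_congr rfl fun b _ => ?_
      rw [← exp_bi]; ring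
    rw [this, hQ, hp]
    field_simp
    ring
  have hpe : 0 ≤ p * (e - 1) := mul_nonneg hp0 (by linarith)
  have e2 : Real.log (1 + p * (e - 1) + Q) ≤ Real.log (1 + p * (e - 1)) + Q := by
    calc _ ≤ Real.log ((1 + p * (e - 1)) * (1 + Q)) := by
          apply Real.log_le_log (by positivity); nlinarith
      _ = Real.log (1 + p * (e - 1)) + Real.log (1 + Q) := by
          rw [Real.log_mul (by positivity) (by positivity)]
      _ ≤ _ := by
          have := Real.log_le_sub_one_of_pos (x := 1 + Q) (by positivity)
          linarith
  have e3 : Real.log (1 + p * (e - 1)) = bi c * (X * ell X r p) := by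
    rw [he, log_bi]; unfold ell; field_simp
  rw [e1, Real.log_mul (by positivity) (by positivity), Real.log_mul hwf.ne' (by positivity),
    he, Real.log_exp]
  linarith

/-- reduction of the arms hidden from the `i`-th potential. -/
lemma hidden_red (wf X r h G : ℝ) (hwf : 0 < wf) (hX : 0 < X) (hr0 : 0 ≤ r) (hr1 : r ≤ 1)
    (v g sg : B → ℝ) (hv : ∀ b, 0 ≤ v b) (hsg : ∀ b, sg b = 0 ∨ sg b = 1)
    (hg : ∀ b, sg b = 1 → g b ≤ G)
    (n2 : ∀ p, 0 ≤ p → p ≤ 1 → (1 - p) * G + ell X 1 p ≤ h) :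
    (∑ b, sg b * v b * g b) / (wf + ∑ b, sg b * v b) +
        ell X r (wf / (wf + ∑ b, sg b * v b)) ≤
      (∑ b, v b * (sg b * g b + (1 - sg b) * h)) / (wf + ∑ b, v b) +
        ell X r (wf / (wf + ∑ b, v b)) := by
  have hsv : ∀ b, 0 ≤ sg b * v b := fun b => by
    have := hv b
    rcases hsg b with h | h <;> rw [h] <;> simp [this]
  have hsv' : ∀ b, sg b * v b ≤ v b := fun b => by
    have := hv b
    rcases hsg b with h | h <;> rw [h] <;> simp [this]
  have e0 : ∑ b, v b * (sg b * g b + (1 - sg b) * h) = ∑ b, sg b * v b * g b +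
      h * (∑ b, v b - ∑ b, sg b * v b) := by
    rw [← Finset.sum_sub_distrib, Finset.mul_sum, ← Finset.sum_add_distrib]
    exact Finset.sum_congr rfl fun b _ => by ring
  have hSG : ∑ b, sg b * v b * g b ≤ (∑ b, sg b * v b) * G := by
    rw [Finset.sum_mul]
    refine Finset.sum_le_sum fun b _ => ?_
    rcases hsg b with h | h
    · simp [h]
    · exact mul_le_mul_of_nonneg_left (hg b h) (hsv b)
  have hWi : 0 ≤ ∑ b, sg b * v b := Finset.sum_nonneg fun b _ => hsv b
  have hWW : ∑ b, sg b * v b ≤ ∑ b, v b := Finset.sum_le_sum fun b _ => hsv' b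
  rw [e0]
  generalize (∑ b, sg b * v b * g b) = S at *
  generalize (∑ b, sg b * v b) = U at *
  generalize (∑ b, v b) = W at *
  have hW : 0 ≤ W := hWi.trans hWW
  have hp0 : 0 ≤ wf / (wf + U) := by positivity
  have hp1 : wf / (wf + U) ≤ 1 := by rw [div_le_one (by positivity)]; linarith
  have hRi : S / (wf + U) + ell X r (wf / (wf + U)) ≤ h := by
    refine le_trans ?_ (n2 _ hp0 hp1)
    have a : S / (wf + U) ≤ (1 - wf / (wf + U)) * G := by
      have : (1 - wf / (wf + U)) * G = U * G / (wf + U) := by field_simp; ring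
      rw [this]; gcongr
    have b := ell_le_one hX hr0 hr1 hp0 hp1
    linarith
  set z := (wf + U) / (wf + W) with hz
  have hz0 : 0 ≤ z := by positivity
  have hz1 : z ≤ 1 := by rw [hz, div_le_one (by positivity)]; linarith
  have c := ell_conc (p := wf / (wf + U)) hX hr0 hp0 hz0 hz1
  have e1 : z * (wf / (wf + U)) = wf / (wf + W) := by rw [hz]; field_simp
  rw [e1] at c
  have e2 : (S + h * (W - U)) / (wf + W) = z * (S / (wf + U)) + (1 - z) * h := by
    rw [hz]; field_simp; ring
  rw [e2]
  have d := mul_le_mul_of_nonneg_left hRi (sub_nonneg.2 hz1)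
  linarith

end scalar

lemma kf_eq (x θ g h : ℝ) : kf x θ g h = kf x θ 1 0 * g + (1 - kf x θ 1 0) * h := by
  unfold kf; split_ifs <;> simp

lemma kf_01 (x θ : ℝ) : kf x θ 1 0 = 0 ∨ kf x θ 1 0 = 1 := by
  unfold kf; split_ifs <;> simp

noncomputable def Rsum {B I : Type*} [Fintype B] [Fintype I] (m θ : I → ℝ) (X : ℝ) (xb : B → ℝ)
    (wf r : ℝ) (v ρ : B → ℝ) : ℝ :=
  ∑ i, m i * ((∑ b, kf (xb b) (θ i) 1 0 * v b * ((Real.exp (xb b * ρ b) - 1) / xb b)) /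
      (wf + ∑ b, kf (xb b) (θ i) 1 0 * v b) +
    ell X r (wf / (wf + ∑ b, kf (xb b) (θ i) 1 0 * v b)))

lemma Rsum_le {B : Type*} {I : Type} [Fintype B] [Fintype I] {m θ h : I → ℝ} {X C : ℝ}
    (hN : NuOK m θ h X C) (hX : 0 < X) (xb : B → ℝ) (hxb : ∀ b, 0 < xb b) (wf r : ℝ) (hwf : 0 < wf)
    (hr0 : 0 ≤ r) (hr1 : r ≤ 1) (v ρ : B → ℝ) (hv : ∀ b, 0 ≤ v b) (hρ0 : ∀ b, 0 ≤ ρ b)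
    (hρ1 : ∀ b, ρ b ≤ 1) :
    Rsum m θ X xb wf r v ρ ≤ (∑ b, v b *
        ∑ i, m i * kf (xb b) (θ i) ((Real.exp (xb b * ρ b) - 1) / xb b) (h i)) / (wf + ∑ b, v b) +
      ell X r (wf / (wf + ∑ b, v b)) := by
  have e : (∑ b, v b *
        ∑ i, m i * kf (xb b) (θ i) ((Real.exp (xb b * ρ b) - 1) / xb b) (h i)) / (wf + ∑ b, v b) +
      ell X r (wf / (wf + ∑ b, v b)) = ∑ i, m i * ((∑ b, v b *
        (kf (xb b) (θ i) 1 0 * ((Real.exp (xb b * ρ b) - 1) / xb b) +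
          (1 - kf (xb b) (θ i) 1 0) * h i)) / (wf + ∑ b, v b) +
      ell X r (wf / (wf + ∑ b, v b))) := by
    simp only [mul_add (m _) , Finset.sum_add_distrib, ← Finset.sum_mul, hN.m1, one_mul]
    congr 1
    simp only [← mul_div_assoc, ← Finset.sum_div]
    congr 1
    simp only [Finset.mul_sum]
    rw [Finset.sum_comm]
    refine Finset.sum_congr rfl fun i _ => Finset.sum_congr rfl fun b _ => ?_
    rw [kf_eq (xb b)]
    ring
  rw [e]
  unfold Rsum
  refine Finset.sum_le_sum fun i _ => mul_le_mul_of_nonneg_left ?_ (hN.m0 i)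
  refine hidden_red wf X r (h i) ((Real.exp (θ i) - 1) / θ i) hwf hX hr0 hr1 v _ _ hv
    (fun b => kf_01 _ _) (fun b hb => ?_) (hN.n2 i)
  have hle : xb b ≤ θ i := by
    by_contra hc
    rw [kf_neg hc] at hb; norm_num at hb
  refine le_trans ?_ (G_mono (hxb b) hle)
  have := hxb b
  gcongr
  have := hρ1 b
  nlinarith

theorem potential_bound {B α : Type*} {I : Type} [Fintype B] [Fintype α] [Fintype I]
    {m θ h : I → ℝ} {X C η εf : ℝ}
    (hN : NuOK m θ h X C) (hX : 0 < X) (hη : 0 < η) (hε : εf * X = η)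
    (xb : B → ℝ) (hxb : ∀ b, 0 < xb b)
    (w : α → ℝ) (hw0 : ∀ a, 0 ≤ w a) (hw1 : ∑ a, w a = 1) (cI : α → Bool) (J : B → α → Bool)
    (hc : ∑ a, w a * bi (cI a) = εf) (hJ : ∀ b, ∑ a, w a * bi (J b a) = η / xb b)
    (n : ℕ) (rc : ℕ → ℝ) (rb : ℕ → B → ℝ) (hrc : ∀ t, 0 ≤ rc t) (hrb : ∀ t b, 0 ≤ rb t b) :
    ∑ t ∈ Finset.range n, EE w (fun s : Fin n → α => rc t -
      Rsum m θ X xb (Real.exp (hs (fun k a => X * rc k * bi (cI a)) t s)) (rc t)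
        (fun b => Real.exp (hs (fun k a => xb b * rb k b * bi (J b a)) t s)) (rb t)) ≤
    Real.log (1 + Fintype.card B) / η := by
  classical
  set wf : ℕ → (Fin n → α) → ℝ := fun t s => Real.exp (hs (fun k a => X * rc k * bi (cI a)) t s)
    with hwf
  set v : ℕ → (Fin n → α) → B → ℝ :=
    fun t s b => Real.exp (hs (fun k a => xb b * rb k b * bi (J b a)) t s) with hv
  set sg : I → B → ℝ := fun i b => kf (xb b) (θ i) 1 0 with hsg
  have hsg0 : ∀ i b, 0 ≤ sg i b := fun i b => by rcases kf_01 (xb b) (θ i) with h | h <;> simp [sg, h]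
  have hsg1 : ∀ i b, sg i b ≤ 1 := fun i b => by rcases kf_01 (xb b) (θ i) with h | h <;> simp [sg, h]
  have hwf0 : ∀ t s, 0 < wf t s := fun t s => Real.exp_pos _
  have hv0 : ∀ t s b, 0 < v t s b := fun t s b => Real.exp_pos _
  set Φ : ℕ → (Fin n → α) → ℝ := fun t s =>
    ∑ i, m i * (Real.log (wf t s + ∑ b, sg i b * v t s b) - Real.log (wf t s)) with hΦ
  have hU0 : ∀ i t s, 0 ≤ ∑ b, sg i b * v t s b := fun i t s =>
    Finset.sum_nonneg fun b _ => mul_nonneg (hsg0 i b) (hv0 t s b).le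
  have hΦ0 : ∀ t s, 0 ≤ Φ t s := by
    intro t s
    refine Finset.sum_nonneg fun i _ => mul_nonneg (hN.m0 i) (sub_nonneg.2 ?_)
    exact Real.log_le_log (hwf0 t s) (by linarith [hU0 i t s])
  have hΦi : ∀ s, Φ 0 s ≤ Real.log (1 + Fintype.card B) := by
    intro s
    have : Real.log (1 + Fintype.card B) = ∑ i, m i * Real.log (1 + Fintype.card B) := by
      rw [← Finset.sum_mul, hN.m1, one_mul]
    rw [this]
    refine Finset.sum_le_sum fun i _ => mul_le_mul_of_nonneg_left ?_ (hN.m0 i)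
    simp only [hwf, hv, hs_zero, Real.exp_zero, Real.log_one, sub_zero, mul_one]
    apply Real.log_le_log
    · have := Finset.sum_nonneg fun b (_ : b ∈ Finset.univ) => hsg0 i b
      linarith
    · have : ∑ b, sg i b ≤ ∑ _b : B, (1:ℝ) := Finset.sum_le_sum fun b _ => hsg1 i b
      simp at this
      linarith
  have hstep : ∀ t (ht : t < n) s, ∑ a, w a * Φ (t+1) (Function.update s ⟨t, ht⟩ a) ≤
      Φ t s - η * (rc t - Rsum m θ X xb (wf t s) (rc t) (v t s) (rb t)) := by
    intro t ht s
    have e1 : ∀ a, wf (t+1) (Function.update s ⟨t, ht⟩ a) =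
        wf t s * Real.exp (X * rc t * bi (cI a)) := by
      intro a; simp only [hwf, hs_succ, Real.exp_add]
    have e2 : ∀ a b, v (t+1) (Function.update s ⟨t, ht⟩ a) b =
        v t s b * Real.exp (xb b * rb t b * bi (J b a)) := by
      intro a b; simp only [hv, hs_succ, Real.exp_add]
    have e3 : ∀ i, ∑ a, w a * (Real.log (wf (t+1) (Function.update s ⟨t, ht⟩ a) +
          ∑ b, sg i b * v (t+1) (Function.update s ⟨t, ht⟩ a) b) -
          Real.log (wf (t+1) (Function.update s ⟨t, ht⟩ a))) ≤
        (Real.log (wf t s + ∑ b, sg i b * v t s b) - Real.log (wf t s)) - η * rc t +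
        η * ((∑ b, sg i b * v t s b * ((Real.exp (xb b * rb t b) - 1) / xb b)) /
          (wf t s + ∑ b, sg i b * v t s b) +
          ell X (rc t) (wf t s / (wf t s + ∑ b, sg i b * v t s b))) := by
      intro i
      have q := fun a => mul_le_mul_of_nonneg_left (step_log (wf t s) X (rc t) (cI a) (hwf0 t s) hX
        (hrc t) (fun b => sg i b * v t s b) (fun b => xb b * rb t b)
        (fun b => mul_nonneg (hsg0 i b) (hv0 t s b).le)
        (fun b => mul_nonneg (hxb b).le (hrb t b)) (fun b => J b a)) (hw0 a)
      have q2 := Finset.sum_le_sum fun a (_ : a ∈ Finset.univ) => q a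
      simp only [e1, e2]
      have q3 : ∀ a b, sg i b * (v t s b * Real.exp (xb b * rb t b * bi (J b a))) =
        sg i b * v t s b * Real.exp (xb b * rb t b * bi (J b a)) := fun a b => by ring
      simp only [q3]
      refine q2.trans (le_of_eq ?_)
      set U := ∑ b, sg i b * v t s b
      set L := ell X (rc t) (wf t s / (wf t s + U))
      set D := Real.log (wf t s + U) - Real.log (wf t s)
      have q4 : ∀ a, w a * (D - X * rc t * bi (cI a) + bi (cI a) * (X * L) +
          (∑ b, sg i b * v t s b * (bi (J b a) * (Real.exp (xb b * rb t b) - 1))) /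
            (wf t s + U)) =
          w a * D + (w a * bi (cI a)) * (X * L - X * rc t) +
          (∑ b, (w a * bi (J b a)) * (sg i b * v t s b * (Real.exp (xb b * rb t b) - 1))) /
            (wf t s + U) := by
        intro a
        have : ∑ b, (w a * bi (J b a)) * (sg i b * v t s b * (Real.exp (xb b * rb t b) - 1)) =
          w a * ∑ b, sg i b * v t s b * (bi (J b a) * (Real.exp (xb b * rb t b) - 1)) := by
          rw [Finset.mul_sum]
          exact Finset.sum_congr rfl fun b _ => by ring
        rw [this]; ring
      simp only [q4, Finset.sum_add_distrib, ← Finset.sum_mul, ← Finset.sum_div, hw1, hc]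
      rw [Finset.sum_comm]
      simp only [← Finset.sum_mul, hJ]
      have q5 : ∑ b, η / xb b * (sg i b * v t s b * (Real.exp (xb b * rb t b) - 1)) =
          η * ∑ b, sg i b * v t s b * ((Real.exp (xb b * rb t b) - 1) / xb b) := by
        rw [Finset.mul_sum]
        exact Finset.sum_congr rfl fun b _ => by ring
      rw [q5, ← hε]
      ring
    have e4 : ∑ a, w a * Φ (t+1) (Function.update s ⟨t, ht⟩ a) =
        ∑ i, m i * ∑ a, w a * (Real.log (wf (t+1) (Function.update s ⟨t, ht⟩ a) +
          ∑ b, sg i b * v (t+1) (Function.update s ⟨t, ht⟩ a) b) -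
          Real.log (wf (t+1) (Function.update s ⟨t, ht⟩ a))) := by
      simp only [hΦ, Finset.mul_sum]
      rw [Finset.sum_comm]
      exact Finset.sum_congr rfl fun i _ => Finset.sum_congr rfl fun a _ => by ring
    rw [e4]
    refine (Finset.sum_le_sum fun i _ => mul_le_mul_of_nonneg_left (e3 i) (hN.m0 i)).trans
      (le_of_eq ?_)
    have e6 : Rsum m θ X xb (wf t s) (rc t) (v t s) (rb t) = ∑ i, m i *
        ((∑ b, sg i b * v t s b * ((Real.exp (xb b * rb t b) - 1) / xb b)) /
          (wf t s + ∑ b, sg i b * v t s b) +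
          ell X (rc t) (wf t s / (wf t s + ∑ b, sg i b * v t s b))) := rfl
    have e7 : η * rc t = ∑ i, m i * (η * rc t) := by rw [← Finset.sum_mul, hN.m1, one_mul]
    conv_rhs => rw [mul_sub, e6, e7, hΦ]
    rw [Finset.mul_sum, ← Finset.sum_sub_distrib, ← Finset.sum_sub_distrib]
    exact Finset.sum_congr rfl fun i _ => by ring
  have htel : ∀ T, T ≤ n → EE w (Φ T) + η * ∑ t ∈ Finset.range T, EE w (fun s => rc t -
      Rsum m θ X xb (wf t s) (rc t) (v t s) (rb t)) ≤ Real.log (1 + Fintype.card B) := by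
    intro T
    induction T with
    | zero =>
      intro _
      have := EE_mono (ι := Fin n) hw0 hΦi
      rw [EE_const hw1] at this
      simpa using this
    | succ T ih =>
      intro hT
      have a := ih (by omega)
      have b := EE_mono hw0 (hstep T (by omega))
      rw [← EE_resample hw1, EE_sub, EE_mul] at b
      rw [Finset.sum_range_succ, mul_add]
      linarith
  have := htel n le_rfl
  have h0 := EE_nonneg hw0 (hΦ0 n)
  rw [le_div_iff₀ hη]
  linarith

/-! ### The coupling with the surrogate weights -/

def KeyProp (q x X C : ℝ) : Prop := ∀ (n : ℕ) (y : Fin n → ℝ) (ρ wf : ℝ)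
    (W κ : (Fin n → Bool) → ℝ), (∀ k, 0 ≤ y k) → 0 ≤ ρ → ρ ≤ 1 → 0 < wf → (∀ B, 0 ≤ W B) →
    Antitone W → (∀ B, 0 ≤ κ B) → (∀ B, κ B ≤ C) →
    0 ≤ EE (bw q) (fun B =>
      (ρ + x) * (wf * Real.exp (Zf y q B) / (wf * Real.exp (Zf y q B) + W B)) +
        κ B * (wf / (wf + W B) - wf * Real.exp (Zf y q B) /
          (wf * Real.exp (Zf y q B) + W B)) - ell X ρ (wf / (wf + W B)))

lemma keyA {x C : ℝ} (hx : 0 < x) (hx1 : x ≤ 179/100) : KeyProp 1 x x C := by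
  intro n y ρ wf W κ hy hρ0 hρ1 hwf hW _ _ _
  rw [EE_push (fun _ : Unit => true) (fun _ => (1:ℝ)) (bw 1)
    (by intro b; cases b <;> simp [bw])]
  refine EE_nonneg (fun _ => zero_le_one) fun s => ?_
  have hZ : Zf y 1 (fun _ => true) = 0 := by simp [Zf]
  simp only [hZ, Real.exp_zero, mul_one, sub_self, mul_zero, add_zero]
  have hW0 := hW (fun _ => true)
  set p := wf / (wf + W (fun _ => true))
  have hp0 : 0 ≤ p := by positivity
  have h1 := ell_le_lin (X := x) (r := ρ) (p := p) hx hρ0 hp0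
  have h2 := exp_rho (x := x) hρ0 hρ1
  have h3 := exp_quad hx.le hx1
  have h4 : (Real.exp (x * ρ) - 1) / x ≤ ρ + x := by
    rw [div_le_iff₀ hx]
    nlinarith [mul_nonneg hρ0 hx.le, mul_nonneg (mul_nonneg hx.le hx.le) (sub_nonneg.2 hρ1)]
  have h5 := mul_le_mul_of_nonneg_left h4 hp0
  linarith

lemma val_ge {B : Type*} {I : Type} [Fintype B] [Nonempty B] [Fintype I] {m θ h : I → ℝ}
    {X C x : ℝ}
    (hN : NuOK m θ h X C) (hX : 0 < X) (xb : B → ℝ) (hxb : ∀ b, 0 < xb b) (wf wc r : ℝ)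
    (hwf : 0 < wf) (hwc : 0 < wc)
    (hr0 : 0 ≤ r) (hr1 : r ≤ 1) (v ρ : B → ℝ) (hv : ∀ b, 0 < v b) (hρ0 : ∀ b, 0 ≤ ρ b)
    (hρ1 : ∀ b, ρ b ≤ 1) :
    (r + x) * (wc / (wc + ∑ b, v b)) +
      ((∑ b, v b *
        ∑ i, m i * kf (xb b) (θ i) ((Real.exp (xb b * ρ b) - 1) / xb b) (h i)) / ∑ b, v b) *
        (wf / (wf + ∑ b, v b) - wc / (wc + ∑ b, v b)) - ell X r (wf / (wf + ∑ b, v b)) ≤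
    (wc * (r + x) + ∑ b, v b * (ρ b + xb b)) / (wc + ∑ b, v b) -
      Rsum m θ X xb wf r v ρ := by
  have h1 := Rsum_le hN hX xb hxb wf r hwf hr0 hr1 v ρ (fun b => (hv b).le) hρ0 hρ1
  have h2 : ∑ b, v b *
        ∑ i, m i * kf (xb b) (θ i) ((Real.exp (xb b * ρ b) - 1) / xb b) (h i) ≤
      ∑ b, v b * (ρ b + xb b) :=
    Finset.sum_le_sum fun b _ => mul_le_mul_of_nonneg_left
      (hN.n3 _ _ (hxb b) (hρ0 b) (hρ1 b)) (hv b).le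
  have hW : 0 < ∑ b, v b := Finset.sum_pos (fun b _ => hv b) Finset.univ_nonempty
  set S := ∑ b, v b *
        ∑ i, m i * kf (xb b) (θ i) ((Real.exp (xb b * ρ b) - 1) / xb b) (h i)
  set T := ∑ b, v b * (ρ b + xb b)
  set W := ∑ b, v b
  have h3 : (wc * (r + x) + S) / (wc + W) ≤ (wc * (r + x) + T) / (wc + W) := by gcongr
  have h4 : (r + x) * (wc / (wc + W)) + S / W * (wf / (wf + W) - wc / (wc + W)) =
      (wc * (r + x) + S) / (wc + W) - S / (wf + W) := by
    field_simp
    ring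
  linarith

lemma kappa_bound {B : Type*} {I : Type} [Fintype B] [Nonempty B] [Fintype I] {m θ h : I → ℝ}
    {X C : ℝ}
    (hN : NuOK m θ h X C) (hX : 0 < X) (xb : B → ℝ) (hxb : ∀ b, 0 < xb b)
    (v ρ : B → ℝ) (hv : ∀ b, 0 < v b) (hρ0 : ∀ b, 0 ≤ ρ b)
    (hρ1 : ∀ b, ρ b ≤ 1) :
    0 ≤ ((∑ b, v b *
        ∑ i, m i * kf (xb b) (θ i) ((Real.exp (xb b * ρ b) - 1) / xb b) (h i)) / ∑ b, v b) ∧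
    ((∑ b, v b *
        ∑ i, m i * kf (xb b) (θ i) ((Real.exp (xb b * ρ b) - 1) / xb b) (h i)) / ∑ b, v b) ≤ C := by
  have hW : 0 < ∑ b, v b := Finset.sum_pos (fun b _ => hv b) Finset.univ_nonempty
  have hG : ∀ i, (Real.exp (θ i) - 1) / θ i ≤ h i := fun i => by
    have := hN.n2 i 0 le_rfl zero_le_one
    simpa [ell] using this
  have hG0 : ∀ i, 0 ≤ (Real.exp (θ i) - 1) / θ i := fun i => by
    have := Real.one_le_exp (hN.θ0 i).le
    exact div_nonneg (by linarith) (hN.θ0 i).le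
  have hk : ∀ b i, 0 ≤ kf (xb b) (θ i) ((Real.exp (xb b * ρ b) - 1) / xb b) (h i) ∧
      kf (xb b) (θ i) ((Real.exp (xb b * ρ b) - 1) / xb b) (h i) ≤ h i := by
    intro b i
    have hb := hxb b
    by_cases hle : xb b ≤ θ i
    · rw [kf_pos hle]
      constructor
      · have := Real.one_le_exp (mul_nonneg hb.le (hρ0 b))
        exact div_nonneg (by linarith) hb.le
      · refine le_trans ?_ (hG i)
        refine le_trans ?_ (G_mono hb hle)
        gcongr
        have := hρ1 b
        nlinarith
    · rw [kf_neg hle]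
      exact ⟨(hG0 i).trans (hG i), le_rfl⟩
  constructor
  · refine div_nonneg (Finset.sum_nonneg fun b _ => mul_nonneg (hv b).le ?_) hW.le
    exact Finset.sum_nonneg fun i _ => mul_nonneg (hN.m0 i) (hk b i).1
  · rw [div_le_iff₀ hW, Finset.mul_sum]
    refine Finset.sum_le_sum fun b _ => ?_
    rw [mul_comm]
    refine mul_le_mul_of_nonneg_right (le_trans ?_ hN.n4) (hv b).le
    exact Finset.sum_le_sum fun i _ => mul_le_mul_of_nonneg_left (hk b i).2 (hN.m0 i)

def crI {B : Type*} (p : (Bool × B) × Bool) : Bool := p.1.1 && p.2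
def cJ {B : Type*} [DecidableEq B] (b : B) (p : (Bool × B) × Bool) : Bool :=
  !(p.1.1 && p.2) && decide (p.1.2 = b)

noncomputable def cw {B : Type*} (εf q : ℝ) (β : B → ℝ) (p : (Bool × B) × Bool) : ℝ :=
  (fun p1 : Bool × B => bw εf p1.1 * β p1.2) p.1 * bw q p.2

theorem core_bound {B : Type*} {I : Type} [Fintype B] [DecidableEq B] [Nonempty B] [Fintype I]
    {m θ h : I → ℝ} {X C x q η εf : ℝ}
    (hN : NuOK m θ h X C) (hX : 0 < X) (hη : 0 < η) (hε : εf * X = η) (hε0 : 0 ≤ εf) (hε1 : εf ≤ 1)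
    (hq0 : 0 ≤ q) (hq1 : q ≤ 1) (hXq : X = q * x) (hx : 0 ≤ x) (hK : KeyProp q x X C)
    (xb : B → ℝ) (hxb : ∀ b, 0 < xb b) (β : B → ℝ) (hβ0 : ∀ b, 0 ≤ β b) (hβ1 : ∑ b, β b = 1)
    (hβ : ∀ b, β b * (1 - εf * q) = η / xb b)
    (n : ℕ) (rc : ℕ → ℝ) (rb : ℕ → B → ℝ) (hrc : ∀ t, 0 ≤ rc t) (hrb : ∀ t b, 0 ≤ rb t b)
    (hrc1 : ∀ t, rc t ≤ 1) (hrb1 : ∀ t b, rb t b ≤ 1) :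
    ∑ t ∈ Finset.range n, EE (cw εf q β) (fun s : Fin n → (Bool × B) × Bool => rc t -
      (Real.exp (hs (fun k a => x * rc k * bi (crI a)) t s) * (rc t + x) +
        ∑ b, Real.exp (hs (fun k a => xb b * rb k b * bi (cJ b a)) t s) * (rb t b + xb b)) /
      (Real.exp (hs (fun k a => x * rc k * bi (crI a)) t s) +
        ∑ b, Real.exp (hs (fun k a => xb b * rb k b * bi (cJ b a)) t s))) ≤
    Real.log (1 + Fintype.card B) / η := by
  have hw0 : ∀ a, 0 ≤ cw εf q β a := fun a =>
    mul_nonneg (mul_nonneg (bw_nonneg hε0 hε1 _) (hβ0 _)) (bw_nonneg hq0 hq1 _)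
  have hw1 : ∑ a, cw εf q β a = 1 := by
    simp only [cw, Fintype.sum_prod_type, ← Finset.mul_sum, hβ1, bw_sum, mul_one]
  have hc : ∑ a, cw εf q β a * bi a.1.1 = εf := by
    simp only [cw, Fintype.sum_prod_type, mul_right_comm _ (bw q _), ← Finset.mul_sum, bw_sum,
      mul_one]
    simp only [← Finset.sum_mul, ← Finset.mul_sum, hβ1, Fintype.sum_bool]
    simp [bi, bw]
  have hJ : ∀ b, ∑ a, cw εf q β a * bi (cJ b a) = η / xb b := by
    intro b
    rw [← hβ]
    simp only [cw, cJ, Fintype.sum_prod_type, Fintype.sum_bool, bi, bw]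
    simp [Finset.sum_add_distrib]
    ring
  have h0 := potential_bound hN hX hη hε xb hxb (cw εf q β) hw0 hw1 (fun a => a.1.1) cJ hc hJ n rc rb
    hrc hrb
  refine le_trans (Finset.sum_le_sum fun t _ => ?_) h0
  rw [← sub_nonneg, ← EE_sub]
  have hcw : cw εf q β = fun p : (Bool × B) × Bool =>
    (fun p1 : Bool × B => bw εf p1.1 * β p1.2) p.1 * bw q p.2 := rfl
  rw [hcw, EE_prod (fun p1 : Bool × B => bw εf p1.1 * β p1.2) (bw q)]
  refine EE_nonneg (fun a => mul_nonneg (bw_nonneg hε0 hε1 _) (hβ0 _)) fun s1 => ?_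
  set y : Fin n → ℝ := fun k => if k.val < t then x * rc k * bi (s1 k).1 else 0 with hy
  set wf : ℝ := Real.exp (∑ k : Fin n, if k.val < t then X * rc k * bi (s1 k).1 else 0) with hwf
  set v : (Fin n → Bool) → B → ℝ := fun s2 b =>
    Real.exp (hs (fun k a => xb b * rb k b * bi (cJ b a)) t (fun k => (s1 k, s2 k))) with hv
  have hwc : ∀ s2 : Fin n → Bool, Real.exp (hs (fun k a => x * rc k * bi (crI a)) t
      (fun k => (s1 k, s2 k))) = wf * Real.exp (Zf y q s2) := by
    intro s2
    rw [hwf, ← Real.exp_add]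
    congr 1
    unfold hs Zf
    rw [← Finset.sum_add_distrib]
    refine Finset.sum_congr rfl fun k _ => ?_
    simp only [hy, crI, hXq]
    split_ifs <;> cases (s1 k).1 <;> simp_all [bi] <;> ring
  have hv0 : ∀ s2 b, 0 < v s2 b := fun s2 b => Real.exp_pos _
  have hva : ∀ b, Antitone (fun s2 => v s2 b) := by
    intro b s2 s2' hle
    refine Real.exp_le_exp.2 (Finset.sum_le_sum fun k _ => ?_)
    split_ifs
    · refine mul_le_mul_of_nonneg_left ?_ (mul_nonneg (hxb b).le (hrb _ _))
      have := hle k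
      revert this
      simp only [cJ]
      cases s2 k <;> cases s2' k <;> cases (s1 k).1 <;> simp [bi] <;> split_ifs <;> norm_num
    · exact le_rfl
  have key := hK n y (rc t) wf (fun s2 => ∑ b, v s2 b) (fun s2 => ((∑ b, v s2 b *
        ∑ i, m i * kf (xb b) (θ i) ((Real.exp (xb b * rb t b) - 1) / xb b) (h i)) / ∑ b, v s2 b))
    (fun k => by
      simp only [hy]; split_ifs
      · exact mul_nonneg (mul_nonneg hx (hrc _)) (bi_nonneg _)
      · exact le_rfl) (hrc t) (hrc1 t) (Real.exp_pos _)
    (fun s2 => Finset.sum_nonneg fun b _ => (hv0 s2 b).le)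
    (fun s2 s2' hle => Finset.sum_le_sum fun b _ => hva b hle)
    (fun s2 => (kappa_bound hN hX xb hxb (v s2) (rb t) (hv0 s2) (hrb t) (hrb1 t)).1)
    (fun s2 => (kappa_bound hN hX xb hxb (v s2) (rb t) (hv0 s2) (hrb t) (hrb1 t)).2)
  refine key.trans (EE_mono (bw_nonneg hq0 hq1) fun s2 => ?_)
  have V := val_ge (x := x) hN hX xb hxb wf (wf * Real.exp (Zf y q s2)) (rc t) (Real.exp_pos _)
    (mul_pos (Real.exp_pos _) (Real.exp_pos _)) (hrc t) (hrc1 t) (v s2) (rb t) (hv0 s2) (hrb t)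
    (hrb1 t)
  refine V.trans (le_of_eq ?_)
  simp only [hwc]
  have e : Real.exp (hs (fun k (a : (Bool × B) × Bool) => X * rc k * bi a.1.1) t
    (fun k => (s1 k, s2 k))) = wf := rfl
  rw [e]
  ring

/-! ### Bound for a single comparator arm, on the canonical space -/

section arm
variable {𝒜 : Type*} [Fintype 𝒜] [DecidableEq 𝒜]

noncomputable def wt {n : ℕ} (r : ℕ → 𝒜 → ℝ) (πB : 𝒜 → ℝ) (η : ℝ) (t : ℕ) (a : 𝒜)
    (s : Fin n → 𝒜) : ℝ :=
  Real.exp (hs (fun k (u : 𝒜) => η / πB a * r k a * bi (decide (u = a))) t s)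

def phiA (c : 𝒜) (p : (Bool × {b : 𝒜 // b ≠ c}) × Bool) : 𝒜 := if crI p then c else p.1.2.val

lemma phiA_c (c : 𝒜) (p : (Bool × {b : 𝒜 // b ≠ c}) × Bool) : decide (phiA c p = c) = crI p := by
  unfold phiA
  cases h : crI p
  · simpa using p.1.2.2
  · simp

lemma phiA_b (c : 𝒜) (b : {b : 𝒜 // b ≠ c}) (p : (Bool × {b : 𝒜 // b ≠ c}) × Bool) :
    decide (phiA c p = b.val) = cJ b p := by
  unfold phiA cJ
  rw [show (p.1.1 && p.2) = crI p from rfl]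
  cases h : crI p
  · simp [Subtype.ext_iff]
  · simpa using b.2.symm

lemma arm_core {I : Type} [Fintype I] {m θ h : I → ℝ} {X C q η : ℝ}
    (r : ℕ → 𝒜 → ℝ) (hr : ∀ t a, r t a ∈ Set.Icc (0 : ℝ) 1)
    (πB : 𝒜 → ℝ) (hπB_pos : ∀ a, 0 < πB a) (hπB_sum : ∑ a, πB a = 1) (hη : 0 < η) (n : ℕ) (c : 𝒜)
    [Nonempty {b : 𝒜 // b ≠ c}]
    (hN : NuOK m θ h X C) (hX : 0 < X) (hq0 : 0 < q) (hq1 : q ≤ 1)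
    (hXq : X = q * (η / πB c)) (hK : KeyProp q (η / πB c) X C) (hηX : η ≤ X) :
    ∑ t ∈ Finset.range n, EE πB (fun s : Fin n → 𝒜 => r t c -
      (∑ a, wt r πB η t a s * (r t a + η / πB a)) / ∑ a, wt r πB η t a s) ≤
    Real.log (Fintype.card 𝒜) / η := by
  have hc := hπB_pos c
  have hsplit := Fintype.sum_eq_add_sum_subtype_ne πB c
  rw [hπB_sum] at hsplit
  have hpos : 0 < ∑ b : {b : 𝒜 // b ≠ c}, πB b :=
    Finset.sum_pos (fun b _ => hπB_pos _) Finset.univ_nonempty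
  have h1c : 0 < 1 - πB c := by linarith
  have hεq : η / X * q = πB c := by rw [hXq]; field_simp
  have hβ1 : ∑ b : {b : 𝒜 // b ≠ c}, πB b / (1 - πB c) = 1 := by
    rw [← Finset.sum_div, div_eq_one_iff_eq h1c.ne']; linarith
  have core := core_bound (B := {b : 𝒜 // b ≠ c}) (εf := η / X) hN hX hη (by field_simp)
    (by positivity) ((div_le_one hX).2 hηX)
    hq0.le hq1 hXq (by positivity) hK (fun b => η / πB b) (fun b => div_pos hη (hπB_pos _))
    (fun b => πB b / (1 - πB c)) (fun b => div_nonneg (hπB_pos _).le h1c.le) hβ1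
    (fun b => by
      have := hπB_pos b
      rw [hεq]; field_simp) n (fun t => r t c) (fun t b => r t b)
    (fun t => (hr t c).1) (fun t b => (hr t b).1) (fun t => (hr t c).2) (fun t b => (hr t b).2)
  have hcard : (1 : ℝ) + Fintype.card {b : 𝒜 // b ≠ c} = Fintype.card 𝒜 := by
    have := Fintype.sum_eq_add_sum_subtype_ne (fun _ : 𝒜 => (1:ℝ)) c
    simpa using this.symm
  rw [hcard] at core
  refine le_trans (le_of_eq ?_) core
  refine Finset.sum_congr rfl fun t _ => ?_
  rw [EE_push (phiA c) (cw (η / X) q (fun b : {b : 𝒜 // b ≠ c} => πB b / (1 - πB c))) πB]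
  · congr 1
    funext s
    have e1 : wt r πB η t c (fun k => phiA c (s k)) =
        Real.exp (hs (fun k a => η / πB c * r k c * bi (crI a)) t s) := by
      unfold wt hs
      simp only [phiA_c]
    have e2 : ∀ b : {b : 𝒜 // b ≠ c}, wt r πB η t b (fun k => phiA c (s k)) =
        Real.exp (hs (fun k a => η / πB b * r k b * bi (cJ b a)) t s) := by
      intro b
      unfold wt hs
      simp only [phiA_b]
    rw [Fintype.sum_eq_add_sum_subtype_ne _ c, Fintype.sum_eq_add_sum_subtype_ne _ c]
    simp only [e1, e2]
  · intro a
    by_cases ha : a = c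
    · subst ha
      have : ∀ p : (Bool × {b : 𝒜 // b ≠ a}) × Bool, (phiA a p = a) = (crI p = true) := by
        intro p; rw [← phiA_c]; simp
      simp only [this]
      simp only [cw, crI, Fintype.sum_prod_type, Fintype.sum_bool, bw]
      simp [← Finset.sum_mul, ← Finset.mul_sum, hβ1, hεq]
    · have : ∀ p : (Bool × {b : 𝒜 // b ≠ c}) × Bool, (phiA c p = a) = (cJ ⟨a, ha⟩ p = true) := by
        intro p; rw [← phiA_b]; simp
      simp only [this]
      simp only [cw, cJ, Fintype.sum_prod_type, Fintype.sum_bool, bw]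
      simp [Finset.sum_add_distrib]
      have : πB a = πB a / (1 - πB c) * (1 - η / X * q) := by
        rw [hεq]; field_simp
      refine this.trans ?_
      ring

theorem arm_bound (hK2 : 2 ≤ Fintype.card 𝒜) {η : ℝ}
    (r : ℕ → 𝒜 → ℝ) (hr : ∀ t a, r t a ∈ Set.Icc (0 : ℝ) 1)
    (πB : 𝒜 → ℝ) (hπB_pos : ∀ a, 0 < πB a) (hπB_sum : ∑ a, πB a = 1) (hη : 0 < η) (n : ℕ) (c : 𝒜) :
    ∑ t ∈ Finset.range n, EE πB (fun s : Fin n → 𝒜 => r t c -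
      (∑ a, wt r πB η t a s * (r t a + η / πB a)) / ∑ a, wt r πB η t a s) ≤
    Real.log (Fintype.card 𝒜) / η := by
  have hNE : Nonempty {b : 𝒜 // b ≠ c} := by
    obtain ⟨b, hb⟩ := Fintype.exists_ne_of_one_lt_card (by omega : 1 < Fintype.card 𝒜) c
    exact ⟨⟨b, hb⟩⟩
  have hc := hπB_pos c
  by_cases hall : ∀ a, 1 ≤ η / πB a
  · refine le_trans (Finset.sum_nonpos fun t _ => ?_) (div_nonneg (Real.log_nonneg ?_) hη.le)
    · have := EE_mono (ι := Fin n) (w := πB) (fun a => (hπB_pos a).le) (F := fun s : Fin n → 𝒜 => r t c -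
        (∑ a, wt r πB η t a s * (r t a + η / πB a)) / ∑ a, wt r πB η t a s) (G := fun _ => 0) ?_
      · rwa [EE_const hπB_sum] at this
      · intro s
        have hw : ∀ a, 0 < wt r πB η t a s := fun a => Real.exp_pos _
        have hW : 0 < ∑ a, wt r πB η t a s := Finset.sum_pos (fun a _ => hw a) ⟨c, Finset.mem_univ c⟩
        rw [sub_nonpos]
        refine (hr t c).2.trans ?_
        rw [le_div_iff₀ hW, one_mul]
        refine Finset.sum_le_sum fun a _ => ?_
        have := hall a
        have := (hr t a).1
        nlinarith [hw a]
    · exact_mod_cast (by omega : 1 ≤ Fintype.card 𝒜)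
  · push Not at hall
    obtain ⟨a, ha⟩ := hall
    have hpa := hπB_pos a
    rw [div_lt_one hpa] at ha
    have ha1 : πB a ≤ 1 := by
      rw [← hπB_sum]; exact Finset.single_le_sum (fun b _ => (hπB_pos b).le) (Finset.mem_univ a)
    have hc1 : πB c ≤ 1 := by
      rw [← hπB_sum]; exact Finset.single_le_sum (fun b _ => (hπB_pos b).le) (Finset.mem_univ c)
    have hx : 0 < η / πB c := by positivity
    have hηx : η ≤ η / πB c := by
      rw [le_div_iff₀ hc]; nlinarith
    rcases le_or_gt (η / πB c) (179/100) with h1 | h1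
    · exact arm_core r hr πB hπB_pos hπB_sum hη n c (nuA hx (by linarith)) hx one_pos le_rfl
        (one_mul _).symm (keyA hx h1) hηx
    rcases le_or_gt (η / πB c) (23/10) with h2 | h2
    · have hac : a ≠ c := by
        rintro rfl
        have : η / πB a < 1 := by rwa [div_lt_one hpa]
        linarith
      have hsum2 : πB a + πB c ≤ 1 := by
        rw [← hπB_sum, ← Finset.sum_pair hac]
        exact Finset.sum_le_sum_of_subset_of_nonneg (Finset.subset_univ _)
          (fun b _ _ => (hπB_pos b).le)
      have hX : 0 < ((1:ℝ)/2)^(0+1) * (η / πB c) := by positivity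
      have hpc : πB c ≤ 1/2 := by
        rw [lt_div_iff₀ hc] at h1
        linarith
      refine arm_core r hr πB hπB_pos hπB_sum hη n c (nuB hX ?_) hX
        (by positivity) (by norm_num) rfl ?_ ?_
      · norm_num; linarith
      · intro n y ρ wf W κ hy hρ0 hρ1 hwf hW hWa hκ0 hκ1
        exact key_corr 0 y hy hρ0 hρ1 (by norm_num) (by linarith) hX hwf W κ hW hWa hκ0 hκ1
          (rangeB rfl h1.le h2)
      · have : η = (η / πB c) * πB c := by field_simp
        norm_num
        nlinarith
    · obtain ⟨j, hj1, hj2⟩ : ∃ j : ℕ, 115/100 ≤ ((1:ℝ)/2)^(j+1) * (η / πB c) ∧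
          ((1:ℝ)/2)^(j+1) * (η / πB c) ≤ 23/10 := by
        have hex : ∃ j : ℕ, ((1:ℝ)/2)^(j+1) * (η / πB c) ≤ 23/10 := by
          obtain ⟨j, hj⟩ := exists_pow_lt_of_lt_one (show (0:ℝ) < (23/10) / (η / πB c) by positivity)
            (show (1:ℝ)/2 < 1 by norm_num)
          refine ⟨j, ?_⟩
          rw [lt_div_iff₀ hx] at hj
          rw [pow_succ]
          have : 0 < ((1:ℝ)/2)^j * (η / πB c) := by positivity
          nlinarith
        classical
        refine ⟨Nat.find hex, ?_, Nat.find_spec hex⟩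
        rcases Nat.eq_zero_or_pos (Nat.find hex) with h0 | h0
        · rw [h0]; norm_num; linarith
        · have := Nat.find_min hex (Nat.sub_lt h0 one_pos)
          rw [show Nat.find hex - 1 + 1 = Nat.find hex by omega] at this
          push Not at this
          rw [pow_succ]; linarith
      have hX : 0 < ((1:ℝ)/2)^(j+1) * (η / πB c) := by positivity
      refine arm_core r hr πB hπB_pos hπB_sum hη n c (nuA hX hj2) hX
        (by positivity) (pow_le_one₀ (by norm_num) (by norm_num)) rfl ?_ (by linarith)
      intro n y ρ wf W κ hy hρ0 hρ1 hwf hW hWa hκ0 hκ1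
      exact key_corr j y hy hρ0 hρ1 (by norm_num) (by linarith) hX hwf W κ hW hWa hκ0 hκ1
        (rangeC j rfl hj1 hj2 h2.le)

end arm

/-! ### From the probability space to the canonical space -/

lemma integral_eq_EE {Ω : Type*} [MeasurableSpace Ω] (μ : Measure Ω) [IsProbabilityMeasure μ]
    {𝒜 : Type*} [Fintype 𝒜] [DecidableEq 𝒜] [MeasurableSpace 𝒜] [MeasurableSingletonClass 𝒜]
    (n : ℕ) (πB : 𝒜 → ℝ) (hπB_pos : ∀ a, 0 < πB a)
    (AB : ℕ → Ω → 𝒜) (hAB_meas : ∀ t, Measurable (AB t))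
    (hAB_indep : iIndepFun AB μ)
    (hAB_law : ∀ t a, μ {ω | AB t ω = a} = ENNReal.ofReal (πB a))
    (F : (Fin n → 𝒜) → ℝ) :
    ∫ ω, F (fun k : Fin n => AB k ω) ∂μ = EE πB F := by
  have hm : Measurable (fun ω (k : Fin n) => AB k ω) := measurable_pi_lambda _ fun k => hAB_meas k
  have h1 : ∀ ω, F (fun k : Fin n => AB k ω) = ∑ s : Fin n → 𝒜,
      Set.indicator ((fun ω (k : Fin n) => AB k ω) ⁻¹' {s}) (fun _ => F s) ω := by
    intro ω
    classical
    simp [Set.indicator_apply]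
  have hms : ∀ s : Fin n → 𝒜, MeasurableSet ((fun ω (k : Fin n) => AB k ω) ⁻¹' {s}) :=
    fun s => hm (measurableSet_singleton s)
  simp only [h1]
  rw [integral_finsetSum _ (fun s _ => (integrable_const (F s)).indicator (hms s))]
  unfold EE
  refine Finset.sum_congr rfl fun s _ => ?_
  rw [integral_indicator (hms s), setIntegral_const, smul_eq_mul]
  congr 1
  have hi : iIndepFun (fun k : Fin n => AB k) μ := hAB_indep.precomp Fin.val_injective
  have := hi.measure_inter_preimage_eq_mul Finset.univ (sets := fun k => {s k})
    (fun k _ => measurableSet_singleton _)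
  have e : ((fun ω (k : Fin n) => AB k ω) ⁻¹' {s}) =
      ⋂ k ∈ (Finset.univ : Finset (Fin n)), AB k ⁻¹' {s k} := by
    ext ω; simp [funext_iff]
  rw [e, measureReal_def, this, ENNReal.toReal_prod]
  refine Finset.prod_congr rfl fun k _ => ?_
  have := hAB_law k (s k)
  rw [show AB k ⁻¹' {s k} = {ω | AB k ω = s k} from rfl, this,
    ENNReal.toReal_ofReal (hπB_pos _).le]

theorem exp3_offpolicy_regret_bound
    {Ω : Type*} [MeasurableSpace Ω] (μ : Measure Ω) [IsProbabilityMeasure μ]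
    {𝒜 : Type*} [Fintype 𝒜] [DecidableEq 𝒜] [MeasurableSpace 𝒜] [MeasurableSingletonClass 𝒜]
    (K : ℕ) (hK : K = Fintype.card 𝒜) (hK2 : 2 ≤ K)
    (n : ℕ) (r : ℕ → 𝒜 → ℝ) (hr : ∀ t a, r t a ∈ Set.Icc (0 : ℝ) 1)
    (πB : 𝒜 → ℝ) (hπB_pos : ∀ a, 0 < πB a) (hπB_sum : ∑ a, πB a = 1)
    (AB : ℕ → Ω → 𝒜) (hAB_meas : ∀ t, Measurable (AB t))
    (hAB_indep : iIndepFun AB μ)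
    (hAB_law : ∀ t a, μ {ω | AB t ω = a} = ENNReal.ofReal (πB a))
    (η : ℝ) (hη : 0 < η)
    (πstar : 𝒜 → ℝ) (hπstar_nonneg : ∀ a, 0 ≤ πstar a) (hπstar_sum : ∑ a, πstar a = 1)
    (rhat : ℕ → 𝒜 → Ω → ℝ)
    (hrhat : ∀ t a ω, rhat t a ω = r t a * (if AB t ω = a then 1 else 0) / πB a)
    (w : ℕ → 𝒜 → Ω → ℝ)
    (hw : ∀ t a ω, w t a ω = Real.exp (η * ∑ k ∈ Finset.range t, rhat k a ω))
    (pol : ℕ → 𝒜 → Ω → ℝ)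
    (hpol : ∀ t a ω, pol t a ω = w t a ω / ∑ a', w t a' ω) :
    ∑ t ∈ Finset.range n, ∑ a, (πstar a - ∫ ω, pol t a ω ∂μ) * r t a ≤
      Real.log K / η +
        η * ∑ t ∈ Finset.range n, ∑ a, (∫ ω, pol t a ω ∂μ) / πB a := by

  have hpolF : ∀ t, t < n → ∀ a ω, pol t a ω = (fun s : Fin n → 𝒜 =>
      wt r πB η t a s / ∑ a', wt r πB η t a' s) (fun k : Fin n => AB k ω) := by
    intro t ht a ω
    have hww : ∀ a, w t a ω = wt r πB η t a (fun k : Fin n => AB k ω) := by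
      intro a
      rw [hw]
      unfold wt hs
      congr 1
      rw [Finset.mul_sum, Fin.sum_univ_eq_sum_range
        (fun k => if k < t then η / πB a * r k a * bi (decide (AB k ω = a)) else 0) n,
        ← Finset.sum_filter]
      have : (Finset.range n).filter (fun k => k < t) = Finset.range t := by
        ext k; simp; omega
      rw [this]
      refine Finset.sum_congr rfl fun k _ => ?_
      rw [hrhat]
      simp only [bi, decide_eq_true_eq]
      ring
    simp only [hpol, hww]
  have hint : ∀ t, t < n → ∀ a, ∫ ω, pol t a ω ∂μ = EE πB (fun s : Fin n → 𝒜 =>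
      wt r πB η t a s / ∑ a', wt r πB η t a' s) := by
    intro t ht a
    simp only [hpolF t ht]
    exact integral_eq_EE μ n πB hπB_pos AB hAB_meas hAB_indep hAB_law
      (fun s : Fin n → 𝒜 => wt r πB η t a s / ∑ a', wt r πB η t a' s)
  subst hK
  have harm := fun c => arm_bound hK2 r hr πB hπB_pos hπB_sum hη n c
  have hval : ∀ t, t < n → ∀ c, EE πB (fun s : Fin n → 𝒜 => r t c -
      (∑ a, wt r πB η t a s * (r t a + η / πB a)) / ∑ a, wt r πB η t a s) =
      r t c - ∑ a, (∫ ω, pol t a ω ∂μ) * (r t a + η / πB a) := by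
    intro t ht c
    rw [EE_sub πB (fun _ => r t c), EE_const hπB_sum]
    congr 1
    simp only [hint t ht, mul_comm (EE _ _), ← EE_mul]
    rw [← EE_sum]
    congr 1
    funext s
    rw [Finset.sum_div]
    exact Finset.sum_congr rfl fun a _ => by ring
  have harm2 : ∀ c, ∑ t ∈ Finset.range n, (r t c -
      ∑ a, (∫ ω, pol t a ω ∂μ) * (r t a + η / πB a)) ≤ Real.log (Fintype.card 𝒜) / η := by
    intro c
    refine le_trans (le_of_eq ?_) (harm c)
    exact Finset.sum_congr rfl fun t ht => (hval t (Finset.mem_range.1 ht) c).symm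
  have havg := Finset.sum_le_sum fun c (_ : c ∈ Finset.univ) =>
    mul_le_mul_of_nonneg_left (harm2 c) (hπstar_nonneg c)
  rw [← Finset.sum_mul, hπstar_sum, one_mul] at havg
  refine le_trans (le_of_eq ?_) (add_le_add_left havg _)
  simp only [Finset.mul_sum]
  rw [Finset.sum_comm (s := (Finset.univ : Finset 𝒜)), ← Finset.sum_add_distrib]
  refine Finset.sum_congr rfl fun t _ => ?_
  have e1 : ∑ c, πstar c * (r t c - ∑ a, (∫ ω, pol t a ω ∂μ) * (r t a + η / πB a)) =
      ∑ c, πstar c * r t c - ∑ a, (∫ ω, pol t a ω ∂μ) * (r t a + η / πB a) := by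
    simp only [mul_sub, Finset.sum_sub_distrib, ← Finset.sum_mul, hπstar_sum, one_mul]
  rw [e1, ← Finset.sum_sub_distrib, ← Finset.sum_add_distrib]
  exact Finset.sum_congr rfl fun a _ => by ring
end
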